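/- arXiv:1910.13424 — 2 statements merged into one kernel-verified Lean document; each statement's English description precedes it below -/
import Mathlib

section
/- Let 0 < m < 1/2, ε > 0, and let F₀ ∈ C²([0,∞)) be sublinear with 0 ≤ F₀(x) ≤ m·x, satisfying (A1)–(A3). Let a ∈ C^∞([0,∞)) be nondecreasing and concave with a(x) = x for x ∈ [0,1] and a(x) = 2 for x ≥ 3. Let F be continuous on [0,∞)×[0,∞), smooth on (0,∞)×(0,∞), solving ∂_t F + (1/2)(∂_x F − m)(∂_x F − m − 1) + F/x − m = ε·a(x)·∂_x² F pointwise on (0,∞)×(0,∞), with F(x,0) = F₀(x), F(0,t) = 0, 0 ≤ F(x,t) ≤ m·x, concave in x, and 0 ≤ ∂_x F ≤ m on (0,∞)×(0,∞). Then for every t ≥ 0: lim_{x→0⁺} ∂_x F(x,t) = m (so x ↦ F(x,t) is C¹ up to x = 0 with ∂_x F(0,t) = m), and lim_{x→0⁺} x·∂_x² F(x,t) = 0. -/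
open Set Filter

/-- A function `ψ : [0,∞) → ℝ` is sublinear if `ψ(x)/x → 0` as `x → ∞`. -/
def Sublinear (ψ : ℝ → ℝ) : Prop :=
  Tendsto (fun x => ψ x / x) atTop (nhds 0)

/-- Partial derivative of `F` in the spatial variable `x`, taken within `[0,∞)`. -/
noncomputable def pX (F : ℝ → ℝ → ℝ) (x t : ℝ) : ℝ :=
  derivWithin (fun y => F y t) (Ici 0) x

/-- Second partial derivative of `F` in `x`, taken within `[0,∞)`. -/
noncomputable def pXX (F : ℝ → ℝ → ℝ) (x t : ℝ) : ℝ :=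
  derivWithin (fun y => pX F y t) (Ici 0) x

/-- Partial derivative of `F` in the time variable `t`. -/
noncomputable def pT (F : ℝ → ℝ → ℝ) (x t : ℝ) : ℝ :=
  deriv (fun s => F x s) t

/-- First derivative of `F₀` on `[0,∞)`. -/
noncomputable def D1 (F₀ : ℝ → ℝ) : ℝ → ℝ := derivWithin F₀ (Ici 0)

/-- Second derivative of `F₀` on `[0,∞)`. -/
noncomputable def D2 (F₀ : ℝ → ℝ) : ℝ → ℝ := derivWithin (derivWithin F₀ (Ici 0)) (Ici 0)

/-- The left derivative at a maximum over the past is nonnegative. -/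
lemma hasDerivAt_nonneg_of_forall_le_left {f : ℝ → ℝ} {f' t r : ℝ} (hr : r < t)
    (hf : HasDerivAt f f' t) (hmax : ∀ s ∈ Ioo r t, f s ≤ f t) : 0 ≤ f' := by
  have h := (hasDerivWithinAt_iff_tendsto_slope' self_notMem_Iio).mp
    (hf.hasDerivWithinAt (s := Iio t))
  refine ge_of_tendsto h ?_
  filter_upwards [Ioo_mem_nhdsLT hr] with s hs
  rw [slope_def_field]
  exact div_nonneg_of_nonpos (by linarith [hmax s hs]) (by linarith [hs.2])

/-- The second derivative at a local maximum is nonpositive. -/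
lemma IsLocalMax.second_deriv_nonpos {f g : ℝ → ℝ} {x g' : ℝ} (hmax : IsLocalMax f x)
    (hf : ∀ᶠ y in nhds x, HasDerivAt f (g y) y) (hg : HasDerivAt g g' x) : g' ≤ 0 := by
  by_contra! hpos
  have hfx := hf.self_of_nhds
  have hderiv : deriv f =ᶠ[nhds x] g := hf.mono fun y hy => hy.deriv
  have hmin : IsLocalMin f x := by
    refine isLocalMin_of_deriv_deriv_pos ?_ hmax.deriv_eq_zero hfx.continuousAt
    rwa [hderiv.deriv_eq, hg.deriv]
  have hconst : f =ᶠ[nhds x] fun _ => f x := by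
    filter_upwards [hmax, hmin] with y h₁ h₂ using le_antisymm h₁ h₂
  have hg0 : g =ᶠ[nhds x] fun _ => 0 := by
    filter_upwards [hconst.eventuallyEq_nhds, hf] with y h₁ h₂
    rw [← h₂.deriv, h₁.deriv_eq, deriv_const]
  have : g' = 0 := by rw [← hg.deriv, hg0.deriv_eq, deriv_const]
  exact hpos.ne' this

/-- Maximum principle on the half line: a function of at most linear growth satisfying
`d_t ≤ κ d_xx + c d_x - d / x` with `0 ≤ κ ≤ K` and `0 ≤ c ≤ 1` stays nonpositive if it is
nonpositive on the parabolic boundary. -/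
lemma nonpos_of_parabolic_inequality {T K M : ℝ} {d dt dx dxx κ c : ℝ → ℝ → ℝ}
    (hcont : ContinuousOn (fun p : ℝ × ℝ => d p.1 p.2) (Ici 0 ×ˢ Icc 0 T))
    (hinit : ∀ x, 0 ≤ x → d x 0 ≤ 0)
    (hbdry : ∀ t ∈ Icc 0 T, d 0 t ≤ 0)
    (hgrowth : ∀ x t, 0 ≤ x → t ∈ Icc 0 T → d x t ≤ M * x)
    (hdt : ∀ x t, 0 < x → t ∈ Ioc 0 T → HasDerivAt (fun s => d x s) (dt x t) t)
    (hdx : ∀ x t, 0 < x → t ∈ Ioc 0 T → HasDerivAt (fun y => d y t) (dx x t) x)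
    (hdxx : ∀ x t, 0 < x → t ∈ Ioc 0 T → HasDerivAt (fun y => dx y t) (dxx x t) x)
    (hκ : ∀ x t, 0 < x → t ∈ Ioc 0 T → κ x t ∈ Icc 0 K)
    (hc : ∀ x t, 0 < x → t ∈ Ioc 0 T → c x t ∈ Icc 0 1)
    (hineq : ∀ x t, 0 < x → t ∈ Ioc 0 T →
      dt x t ≤ κ x t * dxx x t + c x t * dx x t - d x t / x) :
    ∀ x t, 0 ≤ x → t ∈ Icc 0 T → d x t ≤ 0 := by
  intro x₀ t₀ hx₀ ht₀
  set L := 2 * |K| + 2 with hL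
  suffices H : ∀ δ > 0, d x₀ t₀ ≤ δ * ((1 + x₀ ^ 2) * Real.exp (L * t₀)) by
    set G := (1 + x₀ ^ 2) * Real.exp (L * t₀)
    have hG : 0 < G := by positivity
    by_contra! hpos
    have := H (d x₀ t₀ / (2 * G)) (by positivity)
    have h2 : d x₀ t₀ / (2 * G) * G = d x₀ t₀ / 2 := by field_simp
    linarith
  intro δ hδ
  set w : ℝ → ℝ → ℝ := fun x t => d x t - δ * ((1 + x ^ 2) * Real.exp (L * t)) with hw
  suffices hw₀ : w x₀ t₀ ≤ 0 by simp only [hw] at hw₀; linarith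
  set R := |M| / δ + x₀ + 1 with hR
  have hMδ : 0 ≤ |M| / δ := by positivity
  have hcontw : ContinuousOn (fun p : ℝ × ℝ => w p.1 p.2) (Icc 0 R ×ˢ Icc 0 T) := by
    refine (hcont.mono (prod_mono Icc_subset_Ici_self le_rfl)).sub ?_
    exact Continuous.continuousOn (by fun_prop)
  obtain ⟨⟨x₁, t₁⟩, ⟨hx₁, ht₁⟩, hmax⟩ :=
    (isCompact_Icc.prod isCompact_Icc).exists_isMaxOn (f := fun p : ℝ × ℝ => w p.1 p.2)
      ⟨(x₀, t₀), ⟨⟨hx₀, by linarith⟩, ht₀⟩⟩ hcontw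
  simp only at hx₁ ht₁
  have hmax' : ∀ x ∈ Icc 0 R, ∀ t ∈ Icc 0 T, w x t ≤ w x₁ t₁ := fun x hx t ht =>
    hmax (show (x, t) ∈ Icc 0 R ×ˢ Icc 0 T from ⟨hx, ht⟩)
  refine (hmax' x₀ ⟨hx₀, by linarith⟩ t₀ ht₀).trans ?_
  by_contra! hpos
  have hE1 : 1 ≤ Real.exp (L * t₁) := Real.one_le_exp (mul_nonneg (by positivity) ht₁.1)
  have hE : 0 < δ * ((1 + x₁ ^ 2) * Real.exp (L * t₁)) := by positivity
  have hd : 0 < d x₁ t₁ := by simp only [hw] at hpos; linarith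
  have hx₁0 : 0 < x₁ := by
    rcases hx₁.1.eq_or_lt with h | h
    · subst h; linarith [hbdry t₁ ht₁]
    · exact h
  have ht₁0 : 0 < t₁ := by
    rcases ht₁.1.eq_or_lt with h | h
    · subst h; linarith [hinit x₁ hx₁.1]
    · exact h
  have hx₁R : x₁ < R := by
    rcases hx₁.2.eq_or_lt with h | h
    · exfalso
      have h1 := hgrowth x₁ t₁ hx₁.1 ht₁
      have h2 : M * x₁ ≤ |M| * x₁ := by gcongr; exact le_abs_self M
      have h3 : |M| ≤ δ * x₁ := by
        have : δ * (|M| / δ) = |M| := by field_simp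
        rw [h, hR]; nlinarith
      have h4 : |M| * x₁ ≤ δ * (1 + x₁ ^ 2) := by nlinarith
      have h5 : δ * (1 + x₁ ^ 2) * 1 ≤ δ * (1 + x₁ ^ 2) * Real.exp (L * t₁) := by gcongr
      simp only [hw] at hpos
      linarith
    · exact h
  have ht₁' : t₁ ∈ Ioc 0 T := ⟨ht₁0, ht₁.2⟩
  set E := Real.exp (L * t₁) with hEdef
  have hwt : HasDerivAt (fun s => w x₁ s) (dt x₁ t₁ - δ * ((1 + x₁ ^ 2) * (E * L))) t₁ := by
    refine (hdt x₁ t₁ hx₁0 ht₁').sub (HasDerivAt.const_mul _ (HasDerivAt.const_mul _ ?_))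
    simpa using ((hasDerivAt_id t₁).const_mul L).exp
  have hwx : ∀ y, 0 < y → HasDerivAt (fun y => w y t₁) (dx y t₁ - δ * (2 * y * E)) y := by
    intro y hy
    refine (hdx y t₁ hy ht₁').sub (HasDerivAt.const_mul _ (HasDerivAt.mul_const ?_ _))
    simpa using (hasDerivAt_pow 2 y).const_add 1
  have hwxx : HasDerivAt (fun y => dx y t₁ - δ * (2 * y * E)) (dxx x₁ t₁ - δ * (2 * E)) x₁ := by
    refine (hdxx x₁ t₁ hx₁0 ht₁').sub (HasDerivAt.const_mul _ (HasDerivAt.mul_const ?_ _))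
    simpa using (hasDerivAt_id x₁).const_mul 2
  have h1 := hasDerivAt_nonneg_of_forall_le_left ht₁0 hwt
    (fun s hs => hmax' x₁ hx₁ s ⟨hs.1.le, hs.2.le.trans ht₁.2⟩)
  have hloc : IsLocalMax (fun y => w y t₁) x₁ := by
    filter_upwards [Ioo_mem_nhds hx₁0 hx₁R] with y hy using hmax' y ⟨hy.1.le, hy.2.le⟩ t₁ ht₁
  have h2 := hloc.hasDerivAt_eq_zero (hwx x₁ hx₁0)
  have h3 := hloc.second_deriv_nonpos
    ((eventually_gt_nhds hx₁0).mono fun y hy => hwx y hy) hwxx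
  have h4 := hineq x₁ t₁ hx₁0 ht₁'
  obtain ⟨hκ0, hκK⟩ := hκ x₁ t₁ hx₁0 ht₁'
  obtain ⟨hc0, hc1⟩ := hc x₁ t₁ hx₁0 ht₁'
  have h5 : 0 < d x₁ t₁ / x₁ := div_pos hd hx₁0
  have h6 : κ x₁ t₁ * dxx x₁ t₁ ≤ |K| * (δ * (2 * E)) := by
    have hE2 : 0 ≤ δ * (2 * E) := by positivity
    calc _ ≤ κ x₁ t₁ * (δ * (2 * E)) := by gcongr; linarith
      _ ≤ _ := by gcongr; exact hκK.trans (le_abs_self K)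
  have h7 : c x₁ t₁ * dx x₁ t₁ ≤ δ * (2 * x₁ * E) := by
    have : dx x₁ t₁ = δ * (2 * x₁ * E) := by linarith
    rw [this]
    exact mul_le_of_le_one_left (by positivity) hc1
  have h8 : 0 < δ * E * (2 * (1 + x₁ ^ 2) - 2 * x₁) :=
    mul_pos (by positivity) (by nlinarith [sq_nonneg (x₁ - 1)])
  have h9 : 0 ≤ δ * E * (2 * |K| * x₁ ^ 2) := by positivity
  rw [hL] at h1
  nlinarith

/-- `u` is continuous on `[0,∞) × [0,T]` and has partial derivatives `ut`, `ux`, `uxx`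
on `(0,∞) × (0,T]`. -/
structure ParabolicRegular (T : ℝ) (u ut ux uxx : ℝ → ℝ → ℝ) : Prop where
  continuousOn : ContinuousOn (fun p : ℝ × ℝ => u p.1 p.2) (Ici 0 ×ˢ Icc 0 T)
  hasDerivAt_t : ∀ x t, 0 < x → t ∈ Ioc 0 T → HasDerivAt (fun s => u x s) (ut x t) t
  hasDerivAt_x : ∀ x t, 0 < x → t ∈ Ioc 0 T → HasDerivAt (fun y => u y t) (ux x t) x
  hasDerivAt_xx : ∀ x t, 0 < x → t ∈ Ioc 0 T → HasDerivAt (fun y => ux y t) (uxx x t) x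

namespace ParabolicRegular

variable {T : ℝ} {u ut ux uxx v vt vx vxx : ℝ → ℝ → ℝ}

lemma add (hu : ParabolicRegular T u ut ux uxx) (hv : ParabolicRegular T v vt vx vxx) :
    ParabolicRegular T (fun x t => u x t + v x t) (fun x t => ut x t + vt x t)
      (fun x t => ux x t + vx x t) (fun x t => uxx x t + vxx x t) where
  continuousOn := hu.continuousOn.add hv.continuousOn
  hasDerivAt_t x t hx ht := (hu.hasDerivAt_t x t hx ht).add (hv.hasDerivAt_t x t hx ht)
  hasDerivAt_x x t hx ht := (hu.hasDerivAt_x x t hx ht).add (hv.hasDerivAt_x x t hx ht)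
  hasDerivAt_xx x t hx ht := (hu.hasDerivAt_xx x t hx ht).add (hv.hasDerivAt_xx x t hx ht)

lemma sub (hu : ParabolicRegular T u ut ux uxx) (hv : ParabolicRegular T v vt vx vxx) :
    ParabolicRegular T (fun x t => u x t - v x t) (fun x t => ut x t - vt x t)
      (fun x t => ux x t - vx x t) (fun x t => uxx x t - vxx x t) where
  continuousOn := hu.continuousOn.sub hv.continuousOn
  hasDerivAt_t x t hx ht := (hu.hasDerivAt_t x t hx ht).sub (hv.hasDerivAt_t x t hx ht)
  hasDerivAt_x x t hx ht := (hu.hasDerivAt_x x t hx ht).sub (hv.hasDerivAt_x x t hx ht)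
  hasDerivAt_xx x t hx ht := (hu.hasDerivAt_xx x t hx ht).sub (hv.hasDerivAt_xx x t hx ht)

lemma affine_mul (T b q : ℝ) :
    ParabolicRegular T (fun x t => (b * t + q) * x) (fun x _ => b * x)
      (fun _ t => b * t + q) (fun _ _ => 0) where
  continuousOn := Continuous.continuousOn (by fun_prop)
  hasDerivAt_t x t _ _ := by
    simpa using (((hasDerivAt_id t).const_mul b).add_const q).mul_const x
  hasDerivAt_x x t _ _ := by simpa using (hasDerivAt_id x).const_mul (b * t + q)
  hasDerivAt_xx x t _ _ := hasDerivAt_const _ _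

lemma shift {h : ℝ} (hh : 0 ≤ h) (hu : ParabolicRegular (T + h) u ut ux uxx) :
    ParabolicRegular T (fun x t => u x (t + h)) (fun x t => ut x (t + h))
      (fun x t => ux x (t + h)) (fun x t => uxx x (t + h)) := by
  have hmem : ∀ t ∈ Ioc 0 T, t + h ∈ Ioc 0 (T + h) := fun t ht =>
    ⟨by linarith [ht.1], by linarith [ht.2]⟩
  refine ⟨?_, fun x t hx ht => ?_, fun x t hx ht => hu.hasDerivAt_x x _ hx (hmem t ht),
    fun x t hx ht => hu.hasDerivAt_xx x _ hx (hmem t ht)⟩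
  · refine hu.continuousOn.comp (f := fun p : ℝ × ℝ => (p.1, p.2 + h))
      (Continuous.continuousOn (by fun_prop)) ?_
    rintro ⟨x, t⟩ ⟨hx, ht⟩
    exact ⟨hx, by linarith [ht.1], by linarith [ht.2]⟩
  · exact (hu.hasDerivAt_t x _ hx (hmem t ht)).comp_add_const t h

/-- Space-time functions that are smooth on the open quadrant. -/
lemma of_contDiffOn (T : ℝ) {F : ℝ → ℝ → ℝ}
    (hcont : ContinuousOn (fun p : ℝ × ℝ => F p.1 p.2) (Ici 0 ×ˢ Ici 0))
    (hsmooth : ContDiffOn ℝ (⊤ : ℕ∞) (fun p : ℝ × ℝ => F p.1 p.2) (Ioi 0 ×ˢ Ioi 0)) :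
    ParabolicRegular T F (pT F) (pX F) (pXX F) := by
  have hpX : ∀ t, ∀ x ∈ Ioi (0 : ℝ), pX F x t = deriv (fun y => F y t) x := fun t x hx =>
    derivWithin_of_mem_nhds (Ici_mem_nhds hx)
  have hsec : ∀ t, 0 < t → ContDiffOn ℝ (⊤ : ℕ∞) (fun y => F y t) (Ioi 0) := fun t ht =>
    hsmooth.comp (f := fun y : ℝ => (y, t)) (by fun_prop) fun y hy => ⟨hy, ht⟩
  refine ⟨hcont.mono (prod_mono le_rfl Icc_subset_Ici_self), fun x t hx ht => ?_,
    fun x t hx ht => ?_, fun x t hx ht => ?_⟩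
  · have : ContDiffOn ℝ (⊤ : ℕ∞) (fun s => F x s) (Ioi 0) :=
      hsmooth.comp (f := fun s : ℝ => (x, s)) (by fun_prop) fun s hs => ⟨hx, hs⟩
    exact ((this.contDiffAt (Ioi_mem_nhds ht.1)).differentiableAt (by simp)).hasDerivAt
  · rw [hpX t x hx]
    exact (((hsec t ht.1).contDiffAt (Ioi_mem_nhds hx)).differentiableAt (by simp)).hasDerivAt
  · have hd : DifferentiableAt ℝ (deriv fun y => F y t) x :=
      ((((hsec t ht.1).deriv_of_isOpen (m := 1) isOpen_Ioi (by norm_cast)).contDiffAt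
        (Ioi_mem_nhds hx)).differentiableAt (by simp))
    have hev : (fun y => pX F y t) =ᶠ[nhds x] deriv fun y => F y t :=
      mem_of_superset (Ioi_mem_nhds hx) (hpX t)
    have : pXX F x t = deriv (fun y => pX F y t) x := derivWithin_of_mem_nhds (Ici_mem_nhds hx)
    rw [this]
    exact (hd.congr_of_eventuallyEq hev).hasDerivAt

end ParabolicRegular

/-- The part of the equation `u_t = κ u_xx + H(u_x) - u / x + m` that is nonlinear in `u_x`. -/
noncomputable def flux (m p : ℝ) : ℝ := -(1 / 2) * (p - m) * (p - m - 1)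

/-- Comparison principle for sub- and supersolutions of
`u_t = κ u_xx + flux m u_x - u / x + m`. -/
lemma le_of_sub_super {T K M m : ℝ} {u ut ux uxx v vt vx vxx κ : ℝ → ℝ → ℝ}
    (hu : ParabolicRegular T u ut ux uxx) (hv : ParabolicRegular T v vt vx vxx)
    (hinit : ∀ x, 0 ≤ x → u x 0 ≤ v x 0)
    (hbdry : ∀ t ∈ Icc 0 T, u 0 t ≤ v 0 t)
    (hgrowth : ∀ x t, 0 ≤ x → t ∈ Icc 0 T → u x t ≤ v x t + M * x)
    (hκ : ∀ x t, 0 < x → t ∈ Ioc 0 T → κ x t ∈ Icc 0 K)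
    (hslope : ∀ x t, 0 < x → t ∈ Ioc 0 T → |ux x t + vx x t - 2 * m| ≤ 1)
    (hsub : ∀ x t, 0 < x → t ∈ Ioc 0 T →
      ut x t ≤ κ x t * uxx x t + flux m (ux x t) - u x t / x + m)
    (hsuper : ∀ x t, 0 < x → t ∈ Ioc 0 T →
      κ x t * vxx x t + flux m (vx x t) - v x t / x + m ≤ vt x t) :
    ∀ x t, 0 ≤ x → t ∈ Icc 0 T → u x t ≤ v x t := by
  intro x t hx ht
  have h := hu.sub hv
  refine sub_nonpos.mp (nonpos_of_parabolic_inequality (K := K) (M := M) (κ := κ)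
    (d := fun x t => u x t - v x t) (dt := fun x t => ut x t - vt x t)
    (dx := fun x t => ux x t - vx x t) (c := fun x t => 1 / 2 * (1 + 2 * m - ux x t - vx x t))
    h.continuousOn
    (fun x hx => sub_nonpos.mpr (hinit x hx)) (fun t ht => sub_nonpos.mpr (hbdry t ht))
    (fun x t hx ht => by linarith [hgrowth x t hx ht]) h.hasDerivAt_t h.hasDerivAt_x
    h.hasDerivAt_xx hκ (fun x t hx ht => ?_) (fun x t hx ht => ?_) x t hx ht)
  · have := abs_le.mp (hslope x t hx ht)
    constructor <;> linarith
  · have h1 := hsub x t hx ht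
    have h2 := hsuper x t hx ht
    simp only [flux, sub_div] at *
    nlinarith

/-- If `g` has a right limit at `0`, then `x` times its derivative cannot have a nonzero right limit there. -/
lemma eq_zero_of_tendsto_mul_deriv {g g' : ℝ → ℝ} {p l : ℝ}
    (hg : ∀ x, 0 < x → HasDerivAt g (g' x) x)
    (hp : Tendsto g (nhdsWithin 0 (Ioi 0)) (nhds p))
    (hl : Tendsto (fun x => x * g' x) (nhdsWithin 0 (Ioi 0)) (nhds l)) : l = 0 := by
  have hmv : ∀ x : ℝ, ∃ ξ, 0 < x → ξ ∈ Ioo x (2 * x) ∧ |ξ * g' ξ| ≤ 2 * |g (2 * x) - g x| := by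
    intro x
    by_cases hx : 0 < x
    · obtain ⟨ξ, hξ, h⟩ := exists_hasDerivAt_eq_slope g g' (by linarith : x < 2 * x)
        (fun y hy => (hg y (hx.trans_le hy.1)).continuousAt.continuousWithinAt)
        (fun y hy => hg y (hx.trans hy.1))
      refine ⟨ξ, fun _ => ⟨hξ, ?_⟩⟩
      have h2 : g (2 * x) - g x = x * g' ξ := by rw [h]; field_simp; ring
      rw [h2, abs_mul, abs_mul, abs_of_pos hx, abs_of_pos (hx.trans hξ.1), ← mul_assoc]
      gcongr
      exact hξ.2.le
    · exact ⟨0, fun h => absurd h hx⟩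
  choose ξ hξ using hmv
  have hid : Tendsto (fun x : ℝ => x) (nhdsWithin 0 (Ioi 0)) (nhds 0) :=
    tendsto_id.mono_left nhdsWithin_le_nhds
  have hdouble : Tendsto (fun x : ℝ => 2 * x) (nhdsWithin 0 (Ioi 0)) (nhds 0) := by
    simpa using hid.const_mul 2
  have hdouble' : Tendsto (fun x : ℝ => 2 * x) (nhdsWithin 0 (Ioi 0)) (nhdsWithin 0 (Ioi 0)) :=
    tendsto_nhdsWithin_iff.mpr ⟨hdouble, eventually_nhdsWithin_of_forall fun x hx => by
      simpa using hx⟩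
  have hξ0 : Tendsto ξ (nhdsWithin 0 (Ioi 0)) (nhdsWithin 0 (Ioi 0)) := by
    refine tendsto_nhdsWithin_iff.mpr ⟨?_, ?_⟩
    · exact tendsto_of_tendsto_of_tendsto_of_le_of_le' hid hdouble
        (eventually_nhdsWithin_of_forall fun x hx => (hξ x hx).1.1.le)
        (eventually_nhdsWithin_of_forall fun x hx => (hξ x hx).1.2.le)
    · exact eventually_nhdsWithin_of_forall fun x hx => lt_trans hx (hξ x hx).1.1
  have hbound : Tendsto (fun x => 2 * |g (2 * x) - g x|) (nhdsWithin 0 (Ioi 0)) (nhds 0) := by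
    simpa using (((hp.comp hdouble').sub hp).abs).const_mul 2
  have habs := (hl.comp hξ0).abs
  have : |l| ≤ 0 := le_of_tendsto_of_tendsto habs hbound
    (eventually_nhdsWithin_of_forall fun x hx => (hξ x hx).2)
  exact abs_nonpos_iff.mp this

lemma contDiffOn_D1 {F₀ : ℝ → ℝ} (hC2 : ContDiffOn ℝ 2 F₀ (Ici 0)) :
    ContDiffOn ℝ 1 (D1 F₀) (Ici 0) :=
  hC2.derivWithin (uniqueDiffOn_Ici 0) (by norm_num)

lemma hasDerivAt_D1 {F₀ : ℝ → ℝ} (hC2 : ContDiffOn ℝ 2 F₀ (Ici 0)) {x : ℝ} (hx : 0 < x) :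
    HasDerivAt F₀ (D1 F₀ x) x :=
  ((hC2.differentiableOn (by norm_num) x hx.le).hasDerivWithinAt).hasDerivAt (Ici_mem_nhds hx)

lemma hasDerivAt_D2 {F₀ : ℝ → ℝ} (hC2 : ContDiffOn ℝ 2 F₀ (Ici 0)) {x : ℝ} (hx : 0 < x) :
    HasDerivAt (D1 F₀) (D2 F₀ x) x :=
  (((contDiffOn_D1 hC2).differentiableOn (by norm_num) x hx.le).hasDerivWithinAt).hasDerivAt
    (Ici_mem_nhds hx)

lemma parabolicRegular_initial (T : ℝ) {F₀ : ℝ → ℝ} (hC2 : ContDiffOn ℝ 2 F₀ (Ici 0)) :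
    ParabolicRegular T (fun x _ => F₀ x) (fun _ _ => 0) (fun x _ => D1 F₀ x)
      (fun x _ => D2 F₀ x) where
  continuousOn := hC2.continuousOn.comp continuousOn_fst fun _ hp => hp.1
  hasDerivAt_t _ _ _ _ := hasDerivAt_const _ _
  hasDerivAt_x _ _ hx _ := hasDerivAt_D1 hC2 hx
  hasDerivAt_xx _ _ hx _ := hasDerivAt_D2 hC2 hx

lemma le_D1 {F₀ : ℝ → ℝ} {C : ℝ} (hC2 : ContDiffOn ℝ 2 F₀ (Ici 0))
    (hD2 : ∀ x, 0 < x → -C ≤ D2 F₀ x) {x : ℝ} (hx : 0 < x) : D1 F₀ 0 - C * x ≤ D1 F₀ x := by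
  obtain ⟨ξ, hξ, h⟩ := exists_hasDerivAt_eq_slope (D1 F₀) (D2 F₀) hx
    ((contDiffOn_D1 hC2).continuousOn.mono Icc_subset_Ici_self)
    (fun y hy => hasDerivAt_D2 hC2 hy.1)
  rw [sub_zero, eq_div_iff hx.ne'] at h
  nlinarith [hD2 ξ hξ.1]

lemma le_div_of_le_D2 {F₀ : ℝ → ℝ} {C : ℝ} (hC : 0 ≤ C) (hC2 : ContDiffOn ℝ 2 F₀ (Ici 0))
    (h0 : F₀ 0 = 0) (hD2 : ∀ x, 0 < x → -C ≤ D2 F₀ x) {x : ℝ} (hx : 0 < x) :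
    D1 F₀ 0 - C * x ≤ F₀ x / x := by
  obtain ⟨ξ, hξ, h⟩ := exists_hasDerivAt_eq_slope F₀ (D1 F₀) hx
    (hC2.continuousOn.mono Icc_subset_Ici_self) (fun y hy => hasDerivAt_D1 hC2 hy.1)
  rw [h0, sub_zero, sub_zero] at h
  rw [← h]
  have := le_D1 hC2 hD2 hξ.1
  have : C * ξ ≤ C * x := by gcongr; exact hξ.2.le
  linarith

lemma viscosity_bounds {a : ℝ → ℝ} (ha_mono : MonotoneOn a (Ici 0))
    (ha_conc : ConcaveOn ℝ (Ici 0) a) (ha_id : ∀ x ∈ Icc (0 : ℝ) 1, a x = x)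
    (ha_two : ∀ x : ℝ, 3 ≤ x → a x = 2) {x : ℝ} (hx : 0 ≤ x) :
    0 ≤ a x ∧ a x ≤ x ∧ a x ≤ 2 := by
  have h0 : a 0 = 0 := ha_id 0 (by simp)
  have h1 : a 1 = 1 := ha_id 1 (by simp)
  refine ⟨?_, ?_, ?_⟩
  · rw [← h0]; exact ha_mono self_mem_Ici hx hx
  · rcases le_or_gt x 1 with h | h
    · exact (ha_id x ⟨hx, h⟩).le
    · have hx0 : 0 < x := by linarith
      have : (1 - x⁻¹) • a 0 + x⁻¹ • a x ≤ a ((1 - x⁻¹) • 0 + x⁻¹ • x) := ha_conc.2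
        self_mem_Ici hx (sub_nonneg.mpr (inv_le_one_of_one_le₀ h.le)) (by positivity) (by ring)
      simp only [smul_eq_mul, mul_zero, zero_add, h0, inv_mul_cancel₀ hx0.ne', h1] at this
      rwa [inv_mul_le_iff₀ hx0, mul_one] at this
  · rw [← ha_two (max x 3) (le_max_right _ _)]
    exact ha_mono hx (hx.trans (le_max_left _ _)) (le_max_left _ _)

lemma flux_add_le {m p q : ℝ} (hm : m < 1 / 2) (hp : 0 ≤ p) (hq : 0 ≤ q) :
    flux m (p + q) ≤ flux m p + q := by
  simp only [flux]; nlinarith [mul_nonneg hp hq]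

lemma flux_sub_le_flux_sub {m p q : ℝ} (hp : 0 ≤ p) (hq : 0 ≤ q)
    (hq' : q ≤ 1 - 2 * m) : flux m p - q ≤ flux m (p - q) := by
  simp only [flux]; nlinarith [mul_nonneg hp hq]

section

variable {ε m : ℝ} {F₀ a : ℝ → ℝ} {F : ℝ → ℝ → ℝ}

/-- A solution starting from `F₀` moves away from it at most linearly in time,
uniformly relative to `x`. -/
lemma abs_sub_initial_le (hε : 0 < ε) (hm₀ : 0 < m) (hm₁ : m < 1 / 2)
    (hC2 : ContDiffOn ℝ 2 F₀ (Ici 0))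
    (hF₀Bd : ∀ x : ℝ, 0 ≤ x → 0 ≤ F₀ x ∧ F₀ x ≤ m * x)
    (hA1 : (∀ x : ℝ, 0 ≤ x → 0 ≤ D1 F₀ x ∧ D1 F₀ x ≤ m) ∧ D1 F₀ 0 = m)
    (hA2 : ∃ C > 0, ∀ x : ℝ, 0 < x → -C ≤ D2 F₀ x ∧ D2 F₀ x ≤ 0)
    (ha : ∀ x, 0 ≤ x → 0 ≤ a x ∧ a x ≤ x ∧ a x ≤ 2)
    (hreg : ∀ T, ParabolicRegular T F (pT F) (pX F) (pXX F))
    (hPDE : ∀ x t : ℝ, 0 < x → 0 < t →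
      pT F x t = ε * a x * pXX F x t + flux m (pX F x t) - F x t / x + m)
    (hinit : ∀ x : ℝ, 0 ≤ x → F x 0 = F₀ x)
    (hbdry : ∀ t : ℝ, 0 ≤ t → F 0 t = 0)
    (hbd : ∀ x t : ℝ, 0 ≤ x → 0 ≤ t → 0 ≤ F x t ∧ F x t ≤ m * x)
    (hgrad : ∀ x t : ℝ, 0 < x → 0 < t → 0 ≤ pX F x t ∧ pX F x t ≤ m) :
    ∃ B > 0, ∀ h, 0 ≤ h → B * h ≤ 1 - 2 * m → ∀ x, 0 ≤ x → |F x h - F₀ x| ≤ B * h * x := by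
  obtain ⟨C, hC, hD2⟩ := hA2
  have hF₀0 : F₀ 0 = 0 := by
    have := hF₀Bd 0 le_rfl
    rw [mul_zero] at this
    exact le_antisymm this.2 this.1
  refine ⟨ε * C + C, by positivity, fun h hh hBh x hx => ?_⟩
  set B := ε * C + C with hB
  have hB0 : 0 < B := by positivity
  have hκ : ∀ x t, 0 < x → t ∈ Ioc 0 h → ε * a x ∈ Icc 0 (ε * 2) := fun x t hx _ =>
    ⟨mul_nonneg hε.le (ha x hx.le).1, by gcongr; exact (ha x hx.le).2.2⟩
  have hBt : ∀ t ∈ Ioc 0 h, 0 ≤ B * t ∧ B * t ≤ 1 - 2 * m := fun t ht =>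
    ⟨mul_nonneg hB0.le ht.1.le, le_trans (by gcongr; exact ht.2) hBh⟩
  have hreg₀ := parabolicRegular_initial h hC2
  have hD1 : ∀ x, 0 < x → m - C * x ≤ D1 F₀ x := fun x hx => by
    have := le_D1 hC2 (fun x hx => (hD2 x hx).1) hx
    rwa [hA1.2] at this
  have hdiv : ∀ x, 0 < x → m - C * x ≤ F₀ x / x ∧ F₀ x / x ≤ m := fun x hx => by
    have := le_div_of_le_D2 hC.le hC2 hF₀0 (fun x hx => (hD2 x hx).1) hx
    rw [hA1.2] at this
    exact ⟨this, (div_le_iff₀ hx).mpr (hF₀Bd x hx.le).2⟩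
  have hupper := le_of_sub_super (K := ε * 2) (M := m) (m := m) (κ := fun x _ => ε * a x)
    (hreg h) (hreg₀.add (.affine_mul h B 0)) (fun x hx => by simp [hinit x hx])
    (fun t ht => by simp [hbdry t ht.1, hF₀0])
    (fun x t hx ht => by
      have h1 := (hbd x t hx ht.1).2
      have h2 := (hF₀Bd x hx).1
      have h3 : 0 ≤ (B * t + 0) * x :=
        mul_nonneg (by rw [add_zero]; exact mul_nonneg hB0.le ht.1) hx
      linarith)
    hκ
    (fun x t hx ht => by
      have h1 := hgrad x t hx ht.1
      have h2 := hA1.1 x hx.le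
      have h3 := hBt t ht
      rw [abs_le]; constructor <;> linarith)
    (fun x t hx ht => (hPDE x t hx ht.1).le)
    (fun x t hx ht => by
      have h1 := hA1.1 x hx.le
      have h2 := flux_add_le hm₁ h1.1 (hBt t ht).1
      have h3 : flux m (D1 F₀ x) ≤ 0 := by
        simp only [flux]; nlinarith
      have h4 : ε * a x * D2 F₀ x ≤ 0 :=
        mul_nonpos_of_nonneg_of_nonpos (hκ x t hx ht).1 (hD2 x hx).2
      have h5 : C * x ≤ B * x := by gcongr; linarith [mul_pos hε hC]
      have h6 := (hdiv x hx).1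
      have h7 : (F₀ x + (B * t + 0) * x) / x = F₀ x / x + B * t := by field_simp; ring
      rw [h7]
      simp only [add_zero]
      linarith) x h hx ⟨hh, le_rfl⟩
  have hlower := le_of_sub_super (K := ε * 2) (M := m) (m := m) (κ := fun x _ => ε * a x)
    (hreg₀.sub (.affine_mul h B 0)) (hreg h) (fun x hx => by simp [hinit x hx])
    (fun t ht => by simp [hbdry t ht.1, hF₀0])
    (fun x t hx ht => by
      have h1 := (hbd x t hx ht.1).1
      have h2 := (hF₀Bd x hx).2
      have h3 : 0 ≤ (B * t + 0) * x :=
        mul_nonneg (by rw [add_zero]; exact mul_nonneg hB0.le ht.1) hx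
      linarith)
    hκ
    (fun x t hx ht => by
      have h1 := hgrad x t hx ht.1
      have h2 := hA1.1 x hx.le
      have h3 := hBt t ht
      rw [abs_le]; constructor <;> linarith)
    (fun x t hx ht => by
      have h1 := hA1.1 x hx.le
      have h2 := flux_sub_le_flux_sub h1.1 (hBt t ht).1 (hBt t ht).2
      have h3 : -(C * x) ≤ flux m (D1 F₀ x) := by
        have := hD1 x hx
        simp only [flux]; nlinarith
      have h4 : -(ε * C * x) ≤ ε * a x * D2 F₀ x := by
        have h8 : ε * a x * -C ≤ ε * a x * D2 F₀ x :=
          mul_le_mul_of_nonneg_left (hD2 x hx).1 (hκ x t hx ht).1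
        have h9 : ε * C * a x ≤ ε * C * x := by gcongr; exact (ha x hx.le).2.1
        linarith
      have h6 := (hdiv x hx).2
      have h7 : (F₀ x - (B * t + 0) * x) / x = F₀ x / x - B * t := by field_simp; ring
      rw [h7]
      simp only [add_zero, sub_zero]
      have h10 : B * x = ε * C * x + C * x := by rw [hB]; ring
      linarith)
    (fun x t hx ht => (hPDE x t hx ht.1).ge) x h hx ⟨hh, le_rfl⟩
  rw [add_zero] at hupper hlower
  exact abs_le.mpr ⟨by linarith, by linarith⟩

/-- If a solution moves by at most `q x` during the first time `h`, then the same holds for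
every time interval of length `h`. -/
lemma abs_sub_shift_le {h q : ℝ} (hε : 0 < ε) (hm₀ : 0 < m) (hm₁ : m < 1 / 2)
    (ha : ∀ x, 0 ≤ x → 0 ≤ a x ∧ a x ≤ x ∧ a x ≤ 2)
    (hreg : ∀ T, ParabolicRegular T F (pT F) (pX F) (pXX F))
    (hPDE : ∀ x t : ℝ, 0 < x → 0 < t →
      pT F x t = ε * a x * pXX F x t + flux m (pX F x t) - F x t / x + m)
    (hbdry : ∀ t : ℝ, 0 ≤ t → F 0 t = 0)
    (hbd : ∀ x t : ℝ, 0 ≤ x → 0 ≤ t → 0 ≤ F x t ∧ F x t ≤ m * x)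
    (hgrad : ∀ x t : ℝ, 0 < x → 0 < t → 0 ≤ pX F x t ∧ pX F x t ≤ m)
    (hh : 0 ≤ h) (hq : 0 ≤ q) (hq' : q ≤ 1 - 2 * m)
    (hstart : ∀ x, 0 ≤ x → |F x h - F x 0| ≤ q * x) {x t : ℝ} (hx : 0 ≤ x) (ht : 0 ≤ t) :
    |F x (t + h) - F x t| ≤ q * x := by
  have hκ : ∀ x s, 0 < x → s ∈ Ioc 0 t → ε * a x ∈ Icc 0 (ε * 2) := fun x _ hx _ =>
    ⟨mul_nonneg hε.le (ha x hx.le).1, by gcongr; exact (ha x hx.le).2.2⟩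
  have hadd : ∀ s ∈ Ioc 0 t, 0 < s + h := fun s hs => by linarith [hs.1]
  have hupper := le_of_sub_super (K := ε * 2) (M := m) (m := m) (κ := fun x _ => ε * a x)
    (ParabolicRegular.shift hh (hreg (t + h))) ((hreg t).add (.affine_mul t 0 q))
    (fun x hx => by
      have := (abs_le.mp (hstart x hx)).2
      simp only [zero_add, zero_mul]; linarith)
    (fun s hs => by simp [hbdry s hs.1, hbdry (s + h) (add_nonneg hs.1 hh)])
    (fun x s hx hs => by
      have h1 := (hbd x (s + h) hx (add_nonneg hs.1 hh)).2
      have h2 := (hbd x s hx hs.1).1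
      have h3 : 0 ≤ q * x := mul_nonneg hq hx
      simp only [zero_mul, zero_add]; linarith)
    hκ
    (fun x s hx hs => by
      have h1 := hgrad x s hx hs.1
      have h2 := hgrad x (s + h) hx (hadd s hs)
      rw [abs_le]; constructor <;> linarith)
    (fun x s hx hs => (hPDE x (s + h) hx (hadd s hs)).le)
    (fun x s hx hs => by
      have h1 := flux_add_le hm₁ (hgrad x s hx hs.1).1 hq
      have h7 : (F x s + (0 * s + q) * x) / x = F x s / x + q := by field_simp; ring
      rw [h7, hPDE x s hx hs.1]
      simp only [add_zero, zero_mul, zero_add]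
      linarith) x t hx ⟨ht, le_rfl⟩
  have hlower := le_of_sub_super (K := ε * 2) (M := m) (m := m) (κ := fun x _ => ε * a x)
    ((hreg t).sub (.affine_mul t 0 q)) (ParabolicRegular.shift hh (hreg (t + h)))
    (fun x hx => by
      have := (abs_le.mp (hstart x hx)).1
      simp only [zero_add, zero_mul]; linarith)
    (fun s hs => by simp [hbdry s hs.1, hbdry (s + h) (add_nonneg hs.1 hh)])
    (fun x s hx hs => by
      have h1 := (hbd x (s + h) hx (add_nonneg hs.1 hh)).1
      have h2 := (hbd x s hx hs.1).2
      have h3 : 0 ≤ q * x := mul_nonneg hq hx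
      simp only [zero_mul, zero_add]; linarith)
    hκ
    (fun x s hx hs => by
      have h1 := hgrad x s hx hs.1
      have h2 := hgrad x (s + h) hx (hadd s hs)
      rw [abs_le]; constructor <;> linarith)
    (fun x s hx hs => by
      have h1 := flux_sub_le_flux_sub (hgrad x s hx hs.1).1 hq hq'
      have h7 : (F x s - (0 * s + q) * x) / x = F x s / x - q := by field_simp; ring
      rw [h7, hPDE x s hx hs.1]
      simp only [sub_zero, zero_mul, zero_add]
      linarith)
    (fun x s hx hs => (hPDE x (s + h) hx (hadd s hs)).ge) x t hx ⟨ht, le_rfl⟩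
  simp only [zero_mul, zero_add] at hupper hlower
  exact abs_le.mpr ⟨by linarith, by linarith⟩

end

/-- A function whose forward increments of length `h` are eventually bounded by `q h` has
derivative bounded by `q`. -/
lemma abs_deriv_le_of_forward_increment {f : ℝ → ℝ} {f' t q h₀ : ℝ} (hh₀ : 0 < h₀)
    (hf : HasDerivAt f f' t) (hinc : ∀ h ∈ Ioo 0 h₀, |f (t + h) - f t| ≤ q * h) : |f'| ≤ q := by
  refine le_of_tendsto
    ((hasDerivWithinAt_iff_tendsto_slope' self_notMem_Ioi).mp
      (hf.hasDerivWithinAt (s := Ioi t))).abs ?_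
  filter_upwards [Ioo_mem_nhdsGT (by linarith : t < t + h₀)] with s hs
  have h1 := hinc (s - t) ⟨by linarith [hs.1], by linarith [hs.2]⟩
  have hpos : 0 < s - t := by linarith [hs.1]
  rw [add_sub_cancel] at h1
  rw [slope_def_field, abs_div, abs_of_pos hpos, div_le_iff₀ hpos]
  exact h1

/-- Boundary behavior of a concave profile `f` with slopes `f_x` in `[0, m]` such that
`ε x f_xx + flux m f_x - f / x + m → 0` as `x → 0⁺`. -/
lemma tendsto_of_profile {ε m : ℝ} (hε : 0 < ε) (hm₁ : m < 1 / 2) {f g g' : ℝ → ℝ}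
    (hf : ∀ x, 0 < x → HasDerivAt f (g x) x) (hg : ∀ x, 0 < x → HasDerivAt g (g' x) x)
    (hcont : ContinuousWithinAt f (Ioi 0) 0) (hf0 : f 0 = 0) (hconc : ConcaveOn ℝ (Ici 0) f)
    (hgrad : ∀ x, 0 < x → 0 ≤ g x ∧ g x ≤ m)
    (hlim : Tendsto (fun x => ε * x * g' x + flux m (g x) - f x / x + m)
      (nhdsWithin 0 (Ioi 0)) (nhds 0)) :
    Tendsto g (nhdsWithin 0 (Ioi 0)) (nhds m) ∧
      Tendsto (fun x => x * g' x) (nhdsWithin 0 (Ioi 0)) (nhds 0) := by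
  have hderiv : ∀ x ∈ Ioi (0 : ℝ), deriv f x = g x := fun x hx => (hf x hx).deriv
  have hanti : AntitoneOn g (Ioi 0) := by
    refine AntitoneOn.congr ?_ hderiv
    exact (hconc.subset Ioi_subset_Ici_self (convex_Ioi 0)).antitoneOn_deriv
      fun x hx => (hf x hx).differentiableAt
  obtain ⟨p, hp⟩ : ∃ p, Tendsto g (nhdsWithin 0 (Ioi 0)) (nhds p) :=
    ⟨_, hanti.tendsto_nhdsGT ⟨m, by rintro _ ⟨x, hx, rfl⟩; exact (hgrad x hx).2⟩⟩
  have hp0 : 0 ≤ p := ge_of_tendsto hp (eventually_nhdsWithin_of_forall fun x hx => (hgrad x hx).1)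
  have hquot : Tendsto (fun x => f x / x) (nhdsWithin 0 (Ioi 0)) (nhds p) := by
    have h := hasDerivWithinAt_Ici_of_tendsto_deriv (s := Ioi 0)
      (fun x hx => (hf x hx).differentiableAt.differentiableWithinAt) hcont self_mem_nhdsWithin
      (hp.congr' (eventually_nhdsWithin_of_forall fun x hx => (hderiv x hx).symm))
    have h' := (hasDerivWithinAt_iff_tendsto_slope' self_notMem_Ioi).mp (h.mono Ioi_subset_Ici_self)
    simpa [slope_fun_def_field, hf0] using h'
  have hflux : Tendsto (fun x => flux m (g x)) (nhdsWithin 0 (Ioi 0)) (nhds (flux m p)) := by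
    have : Continuous (flux m) := by unfold flux; fun_prop
    exact (this.tendsto p).comp hp
  have hxg : Tendsto (fun x => x * g' x) (nhdsWithin 0 (Ioi 0))
      (nhds (ε⁻¹ * (0 - flux m p + p - m))) := by
    refine ((((hlim.sub hflux).add hquot).sub_const m).const_mul ε⁻¹).congr fun x => ?_
    field_simp
    ring
  have hl := eq_zero_of_tendsto_mul_deriv hg hp hxg
  have hpm : p = m := by
    have h1 : 0 - flux m p + p - m = 0 := (mul_eq_zero.mp hl).resolve_left (inv_ne_zero hε.ne')
    have h2 : (p - m) * (p - m + 1) = 0 := by simp only [flux] at h1; linarith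
    rcases mul_eq_zero.mp h2 with h | h <;> linarith
  rw [hl] at hxg
  rw [hpm] at hp
  exact ⟨hp, hxg⟩

/-- Boundary behavior at the initial time. -/
lemma tendsto_initial {m : ℝ} {F₀ : ℝ → ℝ} {F : ℝ → ℝ → ℝ}
    (hC2 : ContDiffOn ℝ 2 F₀ (Ici 0)) (hD1 : D1 F₀ 0 = m)
    (hinit : ∀ x : ℝ, 0 ≤ x → F x 0 = F₀ x) :
    Tendsto (fun x => pX F x 0) (nhdsWithin 0 (Ioi 0)) (nhds m) ∧
      Tendsto (fun x => x * pXX F x 0) (nhdsWithin 0 (Ioi 0)) (nhds 0) := by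
  have hpX : ∀ x ∈ Ici (0 : ℝ), pX F x 0 = D1 F₀ x := fun x hx =>
    derivWithin_congr (fun y hy => hinit y hy) (hinit x hx)
  have hpXX : ∀ x ∈ Ici (0 : ℝ), pXX F x 0 = D2 F₀ x := fun x hx =>
    derivWithin_congr hpX (hpX x hx)
  have hD2cont : ContinuousOn (D2 F₀) (Ici 0) :=
    (contDiffOn_D1 hC2).continuousOn_derivWithin (uniqueDiffOn_Ici 0) le_rfl
  have hle : nhdsWithin (0 : ℝ) (Ioi 0) ≤ nhdsWithin 0 (Ici 0) :=
    nhdsWithin_mono _ Ioi_subset_Ici_self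
  constructor
  · have h := ((contDiffOn_D1 hC2).continuousOn 0 self_mem_Ici).tendsto.mono_left hle
    rw [hD1] at h
    exact h.congr' (eventually_nhdsWithin_of_forall fun x hx =>
      (hpX x (Ioi_subset_Ici_self hx)).symm)
  · have hid : Tendsto (fun x : ℝ => x) (nhdsWithin 0 (Ioi 0)) (nhds 0) :=
      tendsto_id.mono_left nhdsWithin_le_nhds
    have h := hid.mul ((hD2cont 0 self_mem_Ici).tendsto.mono_left hle)
    rw [zero_mul] at h
    refine h.congr' (eventually_nhdsWithin_of_forall fun x hx => ?_)
    simp only [hpXX x (Ioi_subset_Ici_self hx)]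

/-- Lemma 3.5, boundary behavior for the degenerate viscous equation.
Let `0 < m < 1/2`, `ε > 0`, `F₀` satisfy (A1)–(A3), and `a` be smooth, nondecreasing,
concave with `a(x) = x` on `[0,1]` and `a(x) = 2` on `[3,∞)`. If `F` solves
`∂ₜF + (1/2)(∂ₓF − m)(∂ₓF − m − 1) + F/x − m = ε·a(x)·∂ₓ²F` on `(0,∞)×(0,∞)`,
with `F(·,0) = F₀`, `F(0,·) = 0`, `0 ≤ F ≤ m·x`, concave in `x`, `0 ≤ ∂ₓF ≤ m`, then for
every `t ≥ 0`: `∂ₓF(x,t) → m` and `x·∂ₓ²F(x,t) → 0` as `x → 0⁺`. -/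
theorem boundary_behavior_degenerate (ε m : ℝ) (hε : 0 < ε) (hm₀ : 0 < m) (hm₁ : m < 1 / 2)
    (F₀ : ℝ → ℝ) (hC2 : ContDiffOn ℝ 2 F₀ (Ici 0))
    (hF₀Sub : Sublinear F₀)
    (hF₀Bd : ∀ x : ℝ, 0 ≤ x → 0 ≤ F₀ x ∧ F₀ x ≤ m * x)
    (hA1 : (∀ x : ℝ, 0 ≤ x → 0 ≤ D1 F₀ x ∧ D1 F₀ x ≤ m) ∧ D1 F₀ 0 = m)
    (hA2 : ∃ C > 0, ∀ x : ℝ, 0 < x → -C ≤ D2 F₀ x ∧ D2 F₀ x ≤ 0)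
    (hA3 : (∀ x : ℝ, 0 < x → -(m / Real.exp 1) ≤ x * D2 F₀ x ∧ x * D2 F₀ x ≤ 0) ∧
      ∃ β ∈ Ioo (0 : ℝ) 1, ∃ C > 0,
        (∀ x : ℝ, 0 ≤ x → |x * D2 F₀ x| ≤ C) ∧
        (∀ x y : ℝ, 0 ≤ x → 0 ≤ y → |x * D2 F₀ x - y * D2 F₀ y| ≤ C * |x - y| ^ β))
    (a : ℝ → ℝ)
    (ha_smooth : ContDiffOn ℝ (⊤ : ℕ∞) a (Ici 0))
    (ha_mono : MonotoneOn a (Ici 0))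
    (ha_conc : ConcaveOn ℝ (Ici 0) a)
    (ha_id : ∀ x ∈ Icc (0 : ℝ) 1, a x = x)
    (ha_two : ∀ x : ℝ, 3 ≤ x → a x = 2)
    (F : ℝ → ℝ → ℝ)
    (hcont : ContinuousOn (fun p : ℝ × ℝ => F p.1 p.2) (Ici 0 ×ˢ Ici 0))
    (hsmooth : ContDiffOn ℝ (⊤ : ℕ∞) (fun p : ℝ × ℝ => F p.1 p.2) (Ioi 0 ×ˢ Ioi 0))
    (hPDE : ∀ x t : ℝ, 0 < x → 0 < t →
      pT F x t + (1 / 2) * (pX F x t - m) * (pX F x t - m - 1) + F x t / x - m =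
        ε * a x * pXX F x t)
    (hinit : ∀ x : ℝ, 0 ≤ x → F x 0 = F₀ x)
    (hbdry : ∀ t : ℝ, 0 ≤ t → F 0 t = 0)
    (hbd : ∀ x t : ℝ, 0 ≤ x → 0 ≤ t → 0 ≤ F x t ∧ F x t ≤ m * x)
    (hconc : ∀ t : ℝ, 0 ≤ t → ConcaveOn ℝ (Ici 0) (fun x => F x t))
    (hgrad : ∀ x t : ℝ, 0 < x → 0 < t → 0 ≤ pX F x t ∧ pX F x t ≤ m) :
    ∀ t : ℝ, 0 ≤ t →
      Tendsto (fun x => pX F x t) (nhdsWithin 0 (Ioi 0)) (nhds m) ∧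
      Tendsto (fun x => x * pXX F x t) (nhdsWithin 0 (Ioi 0)) (nhds 0) := by
  have ha := fun x hx => viscosity_bounds ha_mono ha_conc ha_id ha_two (x := x) hx
  have hreg := fun T => ParabolicRegular.of_contDiffOn T hcont hsmooth
  have hPDE' : ∀ x t : ℝ, 0 < x → 0 < t →
      pT F x t = ε * a x * pXX F x t + flux m (pX F x t) - F x t / x + m := fun x t hx ht => by
    have := hPDE x t hx ht
    simp only [flux]
    linarith
  obtain ⟨B, hB, hstart⟩ := abs_sub_initial_le hε hm₀ hm₁ hC2 hF₀Bd hA1 hA2 ha hreg hPDE' hinit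
    hbdry hbd hgrad
  intro t ht
  rcases ht.eq_or_lt with rfl | ht0
  · exact tendsto_initial hC2 hA1.2 hinit
  have hpT : ∀ x, 0 < x → |pT F x t| ≤ B * x := fun x hx => by
    refine abs_deriv_le_of_forward_increment (h₀ := (1 - 2 * m) / B)
      (div_pos (by linarith) hB) ((hreg t).hasDerivAt_t x t hx ⟨ht0, le_rfl⟩) fun h hh => ?_
    have hBh : B * h ≤ 1 - 2 * m := by rw [mul_comm]; exact ((lt_div_iff₀ hB).mp hh.2).le
    rw [mul_right_comm]
    refine abs_sub_shift_le hε hm₀ hm₁ ha hreg hPDE' hbdry hbd hgrad hh.1.le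
      (mul_nonneg hB.le hh.1.le) hBh (fun y hy => ?_) hx.le ht
    rw [hinit y hy]
    exact hstart h hh.1.le hBh y hy
  refine tendsto_of_profile hε hm₁ (f := fun x => F x t) (g' := fun x => pXX F x t)
    (fun x hx => (hreg t).hasDerivAt_x x t hx ⟨ht0, le_rfl⟩)
    (fun x hx => (hreg t).hasDerivAt_xx x t hx ⟨ht0, le_rfl⟩) ?_ (hbdry t ht) (hconc t ht)
    (fun x hx => hgrad x t hx ht0) ?_
  · exact ((hcont.comp (f := fun x : ℝ => (x, t)) (Continuous.continuousOn (by fun_prop))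
      fun x hx => ⟨hx, ht⟩) 0 self_mem_Ici).mono Ioi_subset_Ici_self
  · have hBx : Tendsto (fun x => B * x) (nhdsWithin 0 (Ioi 0)) (nhds 0) := by
      simpa using (tendsto_id.mono_left nhdsWithin_le_nhds : Tendsto (fun x : ℝ => x)
        (nhdsWithin 0 (Ioi 0)) (nhds 0)).const_mul B
    refine squeeze_zero_norm' ?_ hBx
    filter_upwards [Ioo_mem_nhdsGT (zero_lt_one' ℝ)] with x hx
    have := hPDE' x t hx.1 ht0
    rw [ha_id x ⟨hx.1.le, hx.2.le⟩] at this
    rw [← this]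
    exact hpT x hx.1
end

section
/- Let 0 < m < 1/2 and let F₀ ∈ C²([0,∞)) be sublinear with 0 ≤ F₀(x) ≤ m·x, satisfying (A1)–(A3). Let a ∈ C^∞([0,∞)) be nondecreasing and concave with a(x) = x for x ∈ [0,1] and a(x) = 2 for x ≥ 3. For ε > 0, let F = F^ε be continuous on [0,∞)×[0,∞), smooth on (0,∞)×(0,∞), solving ∂_t F + (1/2)(∂_x F − m)(∂_x F − m − 1) + F/x − m = ε·a(x)·∂_x² F pointwise on (0,∞)×(0,∞), with F(x,0) = F₀(x), F(0,t) = 0, 0 ≤ F(x,t) ≤ m·x, concave in x, and 0 ≤ ∂_x F ≤ m; assume in addition that for each T > 0 the function G(x,t) = x·∂_x² F(x,t) extends to a continuous function on [0,∞)×[0,T] with G(0,t) = 0 which is uniformly Hölder continuous with respect to the parabolic distance s((x₁,t₁),(x₂,t₂)) = |x₁−x₂|/(√x₁+√x₂) + √|t₁−t₂|. Then there exists ε₀ > 0 depending only on m such that for every 0 < ε < ε₀: x·∂_x² F^ε(x,t) ≥ −(1/2 + m) ≥ −1 for every (x,t) ∈ (0,∞)×(0,∞). -/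
open Set Filter

/-- The parabolic distance `s((x₁,t₁),(x₂,t₂)) = |x₁−x₂|/(√x₁+√x₂) + √|t₁−t₂|`. -/
noncomputable def parabolicDist (x₁ t₁ x₂ t₂ : ℝ) : ℝ :=
  |x₁ - x₂| / (Real.sqrt x₁ + Real.sqrt x₂) + Real.sqrt |t₁ - t₂|

/-- A function with a local minimum has nonnegative second derivative there. -/
lemma IsLocalMin.zero_le_of_hasDerivAt_hasDerivAt {g g' : ℝ → ℝ} {c x : ℝ}
    (hmin : IsLocalMin g x) (hg : ∀ᶠ y in nhds x, HasDerivAt g (g' y) y)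
    (hg' : HasDerivAt g' c x) : 0 ≤ c := by
  by_contra! hc
  have hd : deriv g =ᶠ[nhds x] g' := hg.mono fun y hy => hy.deriv
  have hdd : deriv (deriv g) x = c := hd.deriv_eq.trans hg'.deriv
  have hmax : IsLocalMax g x :=
    isLocalMax_of_deriv_deriv_neg (hdd.trans_lt hc) hmin.deriv_eq_zero hg.self_of_nhds.continuousAt
  have hconst : g =ᶠ[nhds x] fun _ => g x := by
    filter_upwards [hmin, hmax] with y h₁ h₂ using le_antisymm h₂ h₁
  have hzero : deriv (deriv g) x = 0 := by
    rw [hconst.deriv.deriv_eq]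
    simp
  exact hc.ne (hdd.symm.trans hzero)

/-- A function that is nonnegative before `t` and vanishes at `t` has nonpositive derivative
at `t`. -/
lemma HasDerivAt.nonpos_of_nonneg_left {g : ℝ → ℝ} {c s t : ℝ} (hg : HasDerivAt g c t)
    (hst : s < t) (h : ∀ r ∈ Ioo s t, 0 ≤ g r) (ht : g t = 0) : c ≤ 0 := by
  have hslope : Tendsto (slope g t) (nhdsWithin t (Iio t)) (nhds c) :=
    (hasDerivWithinAt_iff_tendsto_slope' self_notMem_Iio).1 hg.hasDerivWithinAt
  refine le_of_tendsto hslope ?_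
  filter_upwards [Ioo_mem_nhdsLT hst] with r hr
  rw [slope_def_field, ht, sub_zero]
  exact div_nonpos_of_nonneg_of_nonpos (h r hr) (sub_nonpos.2 hr.2.le)

/-- The open quadrant `(0,∞) × (0,∞)`. -/
def quadrant : Set (ℝ × ℝ) := Ioi 0 ×ˢ Ioi 0

lemma isOpen_quadrant : IsOpen quadrant := isOpen_Ioi.prod isOpen_Ioi

/-- The directional derivative of a function of two variables, as a function of the point. -/
noncomputable def dirDeriv (v : ℝ × ℝ) (g : ℝ × ℝ → ℝ) (z : ℝ × ℝ) : ℝ := fderiv ℝ g z v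

lemma ContDiffOn.dirDeriv {g : ℝ × ℝ → ℝ} (hg : ContDiffOn ℝ (⊤ : ℕ∞) g quadrant) (v : ℝ × ℝ) :
    ContDiffOn ℝ (⊤ : ℕ∞) (dirDeriv v g) quadrant :=
  (hg.fderiv_of_isOpen isOpen_quadrant (by simp)).clm_apply contDiffOn_const

lemma ContDiffOn.hasFDerivAt_quadrant {g : ℝ × ℝ → ℝ} (hg : ContDiffOn ℝ (⊤ : ℕ∞) g quadrant)
    {z : ℝ × ℝ} (hz : z ∈ quadrant) : HasFDerivAt g (fderiv ℝ g z) z :=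
  ((hg.contDiffAt (isOpen_quadrant.mem_nhds hz)).differentiableAt (by simp)).hasFDerivAt

lemma ContDiffOn.hasDerivAt_fst {g : ℝ × ℝ → ℝ} (hg : ContDiffOn ℝ (⊤ : ℕ∞) g quadrant)
    {x t : ℝ} (hx : 0 < x) (ht : 0 < t) :
    HasDerivAt (fun y => g (y, t)) (_root_.dirDeriv (1, 0) g (x, t)) x :=
  (hg.hasFDerivAt_quadrant (z := (x, t)) ⟨hx, ht⟩).comp_hasDerivAt x
    ((hasDerivAt_id x).prodMk (hasDerivAt_const x t))

lemma ContDiffOn.hasDerivAt_snd {g : ℝ × ℝ → ℝ} (hg : ContDiffOn ℝ (⊤ : ℕ∞) g quadrant)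
    {x t : ℝ} (hx : 0 < x) (ht : 0 < t) :
    HasDerivAt (fun s => g (x, s)) (_root_.dirDeriv (0, 1) g (x, t)) t :=
  (hg.hasFDerivAt_quadrant (z := (x, t)) ⟨hx, ht⟩).comp_hasDerivAt t
    ((hasDerivAt_const t x).prodMk (hasDerivAt_id t))

lemma ContDiffOn.dirDeriv_comm {g : ℝ × ℝ → ℝ} (hg : ContDiffOn ℝ (⊤ : ℕ∞) g quadrant)
    (v w : ℝ × ℝ) {z : ℝ × ℝ} (hz : z ∈ quadrant) :
    _root_.dirDeriv v (_root_.dirDeriv w g) z = _root_.dirDeriv w (_root_.dirDeriv v g) z := by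
  have hd : DifferentiableAt ℝ (fderiv ℝ g) z :=
    ((hg.fderiv_of_isOpen (m := (⊤ : ℕ∞)) isOpen_quadrant (by simp)).contDiffAt
      (isOpen_quadrant.mem_nhds hz)).differentiableAt (by simp)
  have hsymm : IsSymmSndFDerivAt ℝ g z :=
    (hg.contDiffAt (isOpen_quadrant.mem_nhds hz)).isSymmSndFDerivAt
      (by simp only [minSmoothness_of_isRCLikeNormedField]; exact WithTop.coe_le_coe.2 (le_top : (2 : ℕ∞) ≤ ⊤))
  have key : ∀ u₁ u₂ : ℝ × ℝ, _root_.dirDeriv u₁ (_root_.dirDeriv u₂ g) z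
      = fderiv ℝ (fderiv ℝ g) z u₁ u₂ := by
    intro u₁ u₂
    have := hd.hasFDerivAt.clm_apply (hasFDerivAt_const u₂ z)
    change fderiv ℝ (fun y => fderiv ℝ g y u₂) z u₁ = _
    rw [this.fderiv]
    simp
  rw [key, key]
  exact hsymm v w

lemma Set.EqOn.dirDeriv_eq {g h : ℝ × ℝ → ℝ} (hgh : EqOn g h quadrant) (v : ℝ × ℝ) :
    EqOn (dirDeriv v g) (dirDeriv v h) quadrant := fun z hz => by
  have : g =ᶠ[nhds z] h := hgh.eventuallyEq_of_mem (isOpen_quadrant.mem_nhds hz)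
  simp only [dirDeriv, this.fderiv_eq]

lemma pX_eq_dirDeriv {F : ℝ → ℝ → ℝ}
    (hF : ContDiffOn ℝ (⊤ : ℕ∞) (fun z : ℝ × ℝ => F z.1 z.2) quadrant)
    {x t : ℝ} (hx : 0 < x) (ht : 0 < t) :
    pX F x t = dirDeriv (1, 0) (fun z : ℝ × ℝ => F z.1 z.2) (x, t) := by
  rw [pX, derivWithin_of_mem_nhds (Ici_mem_nhds hx)]
  exact (hF.hasDerivAt_fst hx ht).deriv

lemma pXX_eq_dirDeriv {F : ℝ → ℝ → ℝ}
    (hF : ContDiffOn ℝ (⊤ : ℕ∞) (fun z : ℝ × ℝ => F z.1 z.2) quadrant)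
    {x t : ℝ} (hx : 0 < x) (ht : 0 < t) :
    pXX F x t = dirDeriv (1, 0) (dirDeriv (1, 0) (fun z : ℝ × ℝ => F z.1 z.2)) (x, t) := by
  rw [pXX, derivWithin_of_mem_nhds (Ici_mem_nhds hx)]
  refine (((hF.dirDeriv (1, 0)).hasDerivAt_fst hx ht).congr_of_eventuallyEq ?_).deriv
  filter_upwards [Ioi_mem_nhds hx] with y hy using pX_eq_dirDeriv hF hy ht

lemma pT_eq_dirDeriv {F : ℝ → ℝ → ℝ}
    (hF : ContDiffOn ℝ (⊤ : ℕ∞) (fun z : ℝ × ℝ => F z.1 z.2) quadrant)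
    {x t : ℝ} (hx : 0 < x) (ht : 0 < t) :
    pT F x t = dirDeriv (0, 1) (fun z : ℝ × ℝ => F z.1 z.2) (x, t) :=
  (hF.hasDerivAt_snd hx ht).deriv

/-- The equation satisfied by `q = f_xx` when `f` solves the viscous equation. -/
lemma dirDeriv_snd_second_derivative_eq {f : ℝ × ℝ → ℝ} {a a₁ a₂ : ℝ → ℝ} {m ε : ℝ}
    (hf : ContDiffOn ℝ (⊤ : ℕ∞) f quadrant)
    (ha₁ : ∀ x, 0 < x → HasDerivAt a (a₁ x) x) (ha₂ : ∀ x, 0 < x → HasDerivAt a₁ (a₂ x) x)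
    (hpde : ∀ x t, 0 < x → 0 < t →
      dirDeriv (0, 1) f (x, t) + (1 / 2) * (dirDeriv (1, 0) f (x, t) - m) *
        (dirDeriv (1, 0) f (x, t) - m - 1) + f (x, t) / x - m =
      ε * a x * dirDeriv (1, 0) (dirDeriv (1, 0) f) (x, t))
    {p q r s : ℝ × ℝ → ℝ} (hp : p = dirDeriv (1, 0) f) (hq : q = dirDeriv (1, 0) p)
    (hr : r = dirDeriv (1, 0) q) (hs : s = dirDeriv (1, 0) r)
    {x t : ℝ} (hx : 0 < x) (ht : 0 < t) :
    dirDeriv (0, 1) q (x, t) =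
      ε * (a₂ x * q (x, t) + 2 * a₁ x * r (x, t) + a x * s (x, t))
        - (p (x, t) - m - 1 / 2) * r (x, t) - q (x, t) ^ 2 - q (x, t) / x
        + 2 * p (x, t) / x ^ 2 - 2 * f (x, t) / x ^ 3 := by
  have cp : ContDiffOn ℝ (⊤ : ℕ∞) p quadrant := hp ▸ hf.dirDeriv _
  have cq : ContDiffOn ℝ (⊤ : ℕ∞) q quadrant := hq ▸ cp.dirDeriv _
  have cr : ContDiffOn ℝ (⊤ : ℕ∞) r quadrant := hr ▸ cq.dirDeriv _
  have hft : ContDiffOn ℝ (⊤ : ℕ∞) (dirDeriv (0, 1) f) quadrant := hf.dirDeriv _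
  have df : ∀ y, 0 < y → HasDerivAt (fun y => f (y, t)) (p (y, t)) y := fun y hy => by
    rw [hp]; exact hf.hasDerivAt_fst hy ht
  have dp : ∀ y, 0 < y → HasDerivAt (fun y => p (y, t)) (q (y, t)) y := fun y hy => by
    rw [hq]; exact cp.hasDerivAt_fst hy ht
  have dq : ∀ y, 0 < y → HasDerivAt (fun y => q (y, t)) (r (y, t)) y := fun y hy => by
    rw [hr]; exact cq.hasDerivAt_fst hy ht
  have dr : ∀ y, 0 < y → HasDerivAt (fun y => r (y, t)) (s (y, t)) y := fun y hy => by
    rw [hs]; exact cr.hasDerivAt_fst hy ht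
  have first : ∀ y, 0 < y → dirDeriv (1, 0) (dirDeriv (0, 1) f) (y, t) =
      ε * (a₁ y * q (y, t) + a y * r (y, t)) - (p (y, t) - m - 1 / 2) * q (y, t)
        - p (y, t) / y + f (y, t) / y ^ 2 := by
    intro y hy
    have h₁ : HasDerivAt (fun y => ε * (a y * q (y, t))
        - (1 / 2) * ((p (y, t) - m) * (p (y, t) - m - 1)) - f (y, t) / y + m)
        _ y := (((((ha₁ y hy).mul (dq y hy)).const_mul ε).sub
          ((((dp y hy).sub_const m).mul (((dp y hy).sub_const m).sub_const 1)).const_mul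
            (1 / 2))).sub ((df y hy).div (hasDerivAt_id y) hy.ne')).add_const m
    have h₂ := h₁.congr_of_eventuallyEq (f₁ := fun y => dirDeriv (0, 1) f (y, t)) (by
      filter_upwards [Ioi_mem_nhds hy] with z hz
      have := hpde z t hz ht
      rw [hq, hp]
      linarith)
    rw [(hft.hasDerivAt_fst hy ht).unique h₂]
    simp only [id]
    have := hy.ne'
    field_simp
    ring
  have second : dirDeriv (1, 0) (dirDeriv (1, 0) (dirDeriv (0, 1) f)) (x, t) =
      ε * (a₂ x * q (x, t) + 2 * a₁ x * r (x, t) + a x * s (x, t))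
        - (p (x, t) - m - 1 / 2) * r (x, t) - q (x, t) ^ 2 - q (x, t) / x
        + 2 * p (x, t) / x ^ 2 - 2 * f (x, t) / x ^ 3 := by
    have h₁ : HasDerivAt (fun y => ε * (a₁ y * q (y, t) + a y * r (y, t))
        - (p (y, t) - m - 1 / 2) * q (y, t) - p (y, t) / y + f (y, t) / y ^ 2) _ x :=
      ((((((ha₂ x hx).mul (dq x hx)).add ((ha₁ x hx).mul (dr x hx))).const_mul ε).sub
        ((((dp x hx).sub_const m).sub_const (1 / 2)).mul (dq x hx))).sub
        ((dp x hx).div (hasDerivAt_id x) hx.ne')).add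
        ((df x hx).div (hasDerivAt_pow 2 x) (pow_ne_zero 2 hx.ne'))
    have h₂ := h₁.congr_of_eventuallyEq
      (f₁ := fun y => dirDeriv (1, 0) (dirDeriv (0, 1) f) (y, t)) (by
        filter_upwards [Ioi_mem_nhds hx] with z hz using first z hz)
    rw [((hft.dirDeriv (1, 0)).hasDerivAt_fst hx ht).unique h₂]
    simp only [id]
    have := hx.ne'
    field_simp
    ring
  have hz : ((x, t) : ℝ × ℝ) ∈ quadrant := ⟨hx, ht⟩
  have comm : EqOn (dirDeriv (0, 1) p) (dirDeriv (1, 0) (dirDeriv (0, 1) f)) quadrant := by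
    rw [hp]
    exact fun z hz => hf.dirDeriv_comm _ _ hz
  rw [hq, cp.dirDeriv_comm _ _ hz, comm.dirDeriv_eq _ hz, ← hq, second]

/-- If a continuous function on `[0,∞) × [0,T]` is positive for `x = 0`, for `t = 0` and for large
`x` but not everywhere, there is a first time at which it touches zero. -/
lemma exists_first_touching {W : ℝ → ℝ → ℝ} {R T : ℝ}
    (hW : ContinuousOn (fun z : ℝ × ℝ => W z.1 z.2) (Ici 0 ×ˢ Icc 0 T))
    (hleft : ∀ t ∈ Icc 0 T, 0 < W 0 t) (hzero : ∀ x, 0 ≤ x → 0 < W x 0)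
    (hfar : ∀ x, R ≤ x → 0 ≤ x → ∀ t ∈ Icc 0 T, 0 < W x t)
    (hneg : ∃ x t, 0 ≤ x ∧ t ∈ Icc 0 T ∧ W x t ≤ 0) :
    ∃ x t, 0 < x ∧ t ∈ Ioc 0 T ∧ W x t = 0 ∧ (∀ y, 0 ≤ y → 0 ≤ W y t) ∧
      ∀ s ∈ Ioo 0 t, 0 ≤ W x s := by
  have near : ∀ x t, 0 ≤ x → t ∈ Icc 0 T → W x t ≤ 0 → x ≤ R := fun x t hx ht h => by
    by_contra! hR
    exact (hfar x hR.le hx t ht).not_ge h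
  have hsub : Icc 0 R ×ˢ Icc 0 T ⊆ (Ici 0 ×ˢ Icc 0 T : Set (ℝ × ℝ)) :=
    prod_mono Icc_subset_Ici_self subset_rfl
  have hcompact : IsCompact ((Icc 0 R ×ˢ Icc 0 T) ∩ {z : ℝ × ℝ | W z.1 z.2 ≤ 0}) :=
    (isCompact_Icc.prod isCompact_Icc).of_isClosed_subset
      ((hW.mono hsub).preimage_isClosed_of_isClosed (isClosed_Icc.prod isClosed_Icc) isClosed_Iic)
      inter_subset_left
  obtain ⟨x₁, t₁, hx₁, ht₁, h₁⟩ := hneg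
  obtain ⟨⟨x, t⟩, ⟨⟨hx, ht⟩, hxt⟩, hmin⟩ := hcompact.exists_isMinOn
    ⟨(x₁, t₁), ⟨⟨hx₁, near x₁ t₁ hx₁ ht₁ h₁⟩, ht₁⟩, h₁⟩ continuous_snd.continuousOn
  change W x t ≤ 0 at hxt
  change x ∈ Icc 0 R at hx
  change t ∈ Icc 0 T at ht
  have before : ∀ y s, 0 ≤ y → 0 ≤ s → s < t → 0 < W y s := fun y s hy hs hst => by
    by_contra! h
    have hsT : s ∈ Icc 0 T := ⟨hs, hst.le.trans ht.2⟩
    have : t ≤ s := isMinOn_iff.1 hmin (y, s) ⟨⟨⟨hy, near y s hy hsT h⟩, hsT⟩, h⟩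
    exact this.not_gt hst
  have hx0 : 0 < x := hx.1.lt_of_ne fun h => by
    subst h
    exact (hleft t ht).not_ge hxt
  have ht0 : 0 < t := ht.1.lt_of_ne fun h => by
    subst h
    exact (hzero x hx.1).not_ge hxt
  have nonneg : ∀ y, 0 ≤ y → 0 ≤ W y t := fun y hy => by
    have hc : ContinuousOn (fun s => W y s) (Icc 0 T) :=
      hW.comp (f := fun s : ℝ => (y, s)) (by fun_prop) fun s hs => ⟨hy, hs⟩
    have hlim : Tendsto (fun s => W y s) (nhdsWithin t (Ioo 0 t)) (nhds (W y t)) :=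
      (hc t ht).mono_left (nhdsWithin_mono t fun s hs => ⟨hs.1.le, hs.2.le.trans ht.2⟩)
    have : (nhdsWithin t (Ioo 0 t)).NeBot := by
      rw [nhdsWithin_Ioo_eq_nhdsLT ht0]
      infer_instance
    refine ge_of_tendsto hlim ?_
    filter_upwards [self_mem_nhdsWithin] with s hs using (before y s hy hs.1.le hs.2).le
  exact ⟨x, t, hx0, ⟨ht0, ht.2⟩, le_antisymm hxt (nonneg x hx.1), nonneg,
    fun s hs => (before x s hx.1 hs.1.le hs.2).le⟩

/-- Properties of the diffusion coefficient. -/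
lemma diffusion_coefficient_bounds {a : ℝ → ℝ} (ha : ContDiffOn ℝ (⊤ : ℕ∞) a (Ici 0))
    (hmono : MonotoneOn a (Ici 0)) (hconc : ConcaveOn ℝ (Ici 0) a)
    (hid : ∀ x ∈ Icc (0 : ℝ) 1, a x = x) {x : ℝ} (hx : 0 < x) :
    HasDerivAt a (deriv a x) x ∧ HasDerivAt (deriv a) (deriv (deriv a) x) x ∧
      0 ≤ a x ∧ a x ≤ x ∧ 0 ≤ deriv a x ∧ x * deriv a x ≤ a x ∧ deriv (deriv a) x ≤ 0 := by
  have ha' : ContDiffOn ℝ (⊤ : ℕ∞) a (Ioi 0) := ha.mono Ioi_subset_Ici_self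
  have hda' : ContDiffOn ℝ (⊤ : ℕ∞) (deriv a) (Ioi 0) := ha'.deriv_of_isOpen isOpen_Ioi (by simp)
  have diff : ∀ y, 0 < y → DifferentiableAt ℝ a y := fun y hy =>
    (ha'.contDiffAt (Ioi_mem_nhds hy)).differentiableAt (by simp)
  have diff' : DifferentiableAt ℝ (deriv a) x :=
    (hda'.contDiffAt (Ioi_mem_nhds hx)).differentiableAt (by simp)
  have a0 : a 0 = 0 := hid 0 (by simp)
  have a1 : a 1 = 1 := hid 1 (by simp)
  have hx0 : x ∈ Ici (0 : ℝ) := hx.le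
  refine ⟨(diff x hx).hasDerivAt, diff'.hasDerivAt, ?_, ?_, ?_, ?_, ?_⟩
  · exact a0.symm.trans_le (hmono self_mem_Ici hx0 hx.le)
  · rcases le_total x 1 with h | h
    · exact (hid x ⟨hx.le, h⟩).le
    · have h₁ := hconc.2 hx0 (self_mem_Ici : (0 : ℝ) ∈ Ici 0)
        (show 0 ≤ 1 / x by positivity) (sub_nonneg.2 ((div_le_one hx).2 h)) (by ring)
      simp only [smul_eq_mul, a0, mul_zero, add_zero, one_div, inv_mul_cancel₀ hx.ne', a1] at h₁
      rwa [← div_eq_inv_mul, div_le_one hx] at h₁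
  · rw [← (diff x hx).derivWithin (uniqueDiffOn_Ici 0 x hx0)]
    exact hmono.derivWithin_nonneg
  · have h := hconc.deriv_le_slope self_mem_Ici hx0 hx (diff x hx)
    rw [slope_def_field, a0, sub_zero, sub_zero, le_div_iff₀ hx] at h
    linarith
  · have hanti : AntitoneOn (deriv a) (Ioi 0) :=
      (hconc.subset Ioi_subset_Ici_self (convex_Ioi 0)).antitoneOn_deriv diff
    rw [← diff'.derivWithin (isOpen_Ioi.uniqueDiffOn x hx)]
    exact hanti.derivWithin_nonpos

/-- The pointwise inequality contradicting a first touching of the barrier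
`-(1/2 + m) - e * (1 + x)` by `x * q`. -/
lemma no_touching_barrier {m ε x f p q r s q_t a a₁ a₂ e C : ℝ}
    (hε : 0 < ε) (hε₁ : ε < (1 / 2 - m) / 4) (hm₀ : 0 < m)
    (hx : 0 < x) (he : 0 < e) (hf : f ≤ m * x) (hp₀ : 0 ≤ p) (hp₁ : p ≤ m)
    (ha₀ : 0 ≤ a) (hax : a ≤ x) (ha₁ : 0 ≤ a₁) (ha₁' : x * a₁ ≤ a) (ha₂ : a₂ ≤ 0)
    (hq_t : q_t = ε * (a₂ * q + 2 * a₁ * r + a * s) - (p - m - 1 / 2) * r - q ^ 2 - q / x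
      + 2 * p / x ^ 2 - 2 * f / x ^ 3)
    (hG : x * q = -(1 / 2 + m + e * (1 + x))) (hGx : q + x * r = -e)
    (hGxx : 0 ≤ 2 * r + x * s) (hGt : x * q_t ≤ -((C + 4) * (e * (1 + x))))
    (hlarge : 1 ≤ x → e * (1 + x) ≤ C * x) (hC : 0 ≤ C)
    (hsmall : x < 1 → e * (1 + x) ≤ (1 / 2 - m) / 16) : False := by
  have hne := hx.ne'
  have hA : a / x ≤ 1 := (div_le_one hx).2 hax
  have hfx : f / x ≤ m := (div_le_iff₀ hx).2 hf
  have hid : x * (x * q_t) =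
      ε * ((x * q) * (x * a₂ - 2 * a₁ + 2 * (a / x)) + 2 * (q + x * r) * (x * a₁ - a)
        + a * (x * (2 * r + x * s)))
      - (p - m - 1 / 2) * (x * (q + x * r) - x * q) - (x * q) ^ 2 - x * q + 2 * p
      - 2 * (f / x) := by
    rw [hq_t]
    field_simp
    ring
  rw [hG, hGx] at hid
  set d := e * (1 + x) with hd
  have hd₀ : 0 < d := by positivity
  have hex : x * e ≤ d := by rw [hd]; nlinarith
  have hex₀ : 0 < x * e := by positivity
  clear_value d
  have h₁ : -(1 / 2 + m + d) * 2 ≤ -(1 / 2 + m + d) * (x * a₂ - 2 * a₁ + 2 * (a / x)) := by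
    have : x * a₂ ≤ 0 := mul_nonpos_of_nonneg_of_nonpos hx.le ha₂
    exact mul_le_mul_of_nonpos_left (by linarith) (by linarith)
  have h₂ : 0 ≤ 2 * -e * (x * a₁ - a) :=
    mul_nonneg_of_nonpos_of_nonpos (by linarith) (by linarith)
  have h₃ : 0 ≤ a * (x * (2 * r + x * s)) := by positivity
  have h₄ : ε * (-(1 / 2 + m + d) * 2) ≤ ε * (-(1 / 2 + m + d) * (x * a₂ - 2 * a₁ + 2 * (a / x))
      + 2 * -e * (x * a₁ - a) + a * (x * (2 * r + x * s))) :=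
    mul_le_mul_of_nonneg_left (by linarith) hε.le
  have h₅ : x * (x * q_t) ≤ x * -((C + 4) * d) := mul_le_mul_of_nonneg_left hGt hx.le
  have h₆ : -d ≤ -(p - m - 1 / 2) * (x * -e) := by
    have : 0 ≤ (1 - (m + 1 / 2 - p)) * (x * e) := mul_nonneg (by linarith) hex₀.le
    linarith
  have h₇ : (1 / 2 - m) - d * (1 + d) ≤ (p - m - 1 / 2) * (-(1 / 2 + m + d)) + (1 / 2 + m + d)
      - (1 / 2 + m + d) ^ 2 + 2 * p - 2 * (f / x) := by
    have : 0 ≤ p * (2 - (1 / 2 + m)) := mul_nonneg hp₀ (by linarith)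
    have : 0 ≤ d * (2 - (1 / 2 + m) - p) := mul_nonneg hd₀.le (by linarith)
    linarith
  have h₈ : ε * ((1 / 2 + m + d) * 2) ≤ (1 / 2 - m) / 2 + d := by
    have : 0 ≤ ε * (1 / 2 - m) := mul_nonneg hε.le (by linarith)
    have : 0 ≤ d * (1 / 2 - ε) := mul_nonneg hd₀.le (by linarith)
    linarith
  have h₉ : (1 / 2 - m) / 2 + d * ((C + 4) * x - 3 - d) ≤ 0 := by linarith
  rcases lt_or_ge x 1 with h | h
  · have := hsmall h
    have : 0 ≤ d * ((C + 4) * x) := by positivity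
    have : 0 ≤ d * (1 - d) := mul_nonneg hd₀.le (by linarith)
    linarith
  · have := hlarge h
    have : 0 ≤ d * ((C + 4) * x - 3 - d) := mul_nonneg hd₀.le (by linarith)
    linarith

/-- Hölder continuity for the parabolic distance gives at most square root growth. -/
lemma abs_le_sqrt_of_parabolic_holder {G : ℝ → ℝ → ℝ} {C β x t : ℝ} (hβ : β ≤ 1) (hC : 0 ≤ C)
    (hx : 1 ≤ x) (h₀ : G 0 t = 0) (h : |G x t - G 0 t| ≤ C * parabolicDist x t 0 t ^ β) :
    |G x t| ≤ C * √x := by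
  have hdist : parabolicDist x t 0 t = √x := by
    simp [parabolicDist, abs_of_nonneg (zero_le_one.trans hx)]
  rw [h₀, sub_zero, hdist] at h
  refine h.trans (mul_le_mul_of_nonneg_left ?_ hC)
  exact (Real.rpow_le_rpow_of_exponent_le (Real.one_le_sqrt.2 hx) hβ).trans_eq (Real.rpow_one _)

/-- The comparison with the barrier `-(1/2 + m) - δ * exp ((C + 4) * t) * (1 + x)`. -/
lemma barrier_le {m ε T C δ : ℝ} {a : ℝ → ℝ} {F : ℝ → ℝ → ℝ} (hm₀ : 0 < m)
    (hε : 0 < ε) (hε₁ : ε < (1 / 2 - m) / 4)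
    (ha : ContDiffOn ℝ (⊤ : ℕ∞) a (Ici 0)) (hmono : MonotoneOn a (Ici 0))
    (hconc : ConcaveOn ℝ (Ici 0) a) (hid : ∀ x ∈ Icc (0 : ℝ) 1, a x = x)
    (hF : ContDiffOn ℝ (⊤ : ℕ∞) (fun z : ℝ × ℝ => F z.1 z.2) quadrant)
    (hpde : ∀ x t : ℝ, 0 < x → 0 < t →
      pT F x t + (1 / 2) * (pX F x t - m) * (pX F x t - m - 1) + F x t / x - m =
        ε * a x * pXX F x t)
    (hbound : ∀ x t : ℝ, 0 ≤ x → 0 ≤ t → F x t ≤ m * x)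
    (hpX : ∀ x t : ℝ, 0 < x → 0 < t → 0 ≤ pX F x t ∧ pX F x t ≤ m)
    (hcont : ContinuousOn (fun z : ℝ × ℝ => z.1 * pXX F z.1 z.2) (Ici 0 ×ˢ Icc 0 T))
    (hzero : ∀ x, 0 ≤ x → -(1 / 2 + m) < x * pXX F x 0)
    (hC : 0 < C) (hgrowth : ∀ x, 1 ≤ x → ∀ t ∈ Icc 0 T, |x * pXX F x t| ≤ C * √x)
    (hδ : 0 < δ) (hδ₁ : 2 * (δ * Real.exp ((C + 4) * T)) ≤ (1 / 2 - m) / 16)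
    {x t : ℝ} (hx : 0 ≤ x) (ht : t ∈ Icc 0 T) :
    0 ≤ x * pXX F x t + ((1 / 2 + m) + δ * Real.exp ((C + 4) * t) * (1 + x)) := by
  set W : ℝ → ℝ → ℝ := fun x t =>
    x * pXX F x t + ((1 / 2 + m) + δ * Real.exp ((C + 4) * t) * (1 + x)) with hWdef
  by_contra! hneg
  have hexp : ∀ t, 0 ≤ t → δ ≤ δ * Real.exp ((C + 4) * t) := fun t ht =>
    le_mul_of_one_le_right hδ.le (Real.one_le_exp (mul_nonneg (by linarith) ht))
  obtain ⟨y, s, hy, hs, hW₀, hWx, hWt⟩ := exists_first_touching (W := W) (R := (C / δ) ^ 2 + 1)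
    (T := T) (hcont.add (by fun_prop))
    (fun t _ => by simp only [hWdef, zero_mul, zero_add]; positivity)
    (fun x hx => by
      have := hzero x hx
      have : 0 < δ * Real.exp ((C + 4) * 0) * (1 + x) := by positivity
      simp only [hWdef]
      linarith)
    (fun x hxR hx t ht => by
      have hx1 : 1 ≤ x := by nlinarith [sq_nonneg (C / δ)]
      have hg := (abs_le.1 (hgrowth x hx1 t ht)).1
      have hroot : C / δ < √x := Real.lt_sqrt_of_sq_lt (by linarith)
      rw [div_lt_iff₀ hδ] at hroot
      have hlt : C * √x ≤ δ * x := by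
        calc C * √x ≤ √x * δ * √x := mul_le_mul_of_nonneg_right hroot.le (Real.sqrt_nonneg x)
          _ = δ * (√x * √x) := by ring
          _ = δ * x := by rw [Real.mul_self_sqrt hx]
      have : δ * x ≤ δ * Real.exp ((C + 4) * t) * (1 + x) :=
        mul_le_mul (hexp t ht.1) (by linarith) hx (by positivity)
      simp only [hWdef]
      linarith)
    ⟨x, t, hx, ht, hneg.le⟩
  have hs0 := hs.1
  have hsT : s ∈ Icc 0 T := ⟨hs.1.le, hs.2⟩
  set f : ℝ × ℝ → ℝ := fun z => F z.1 z.2 with hf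
  set p := dirDeriv (1, 0) f with hp
  set q := dirDeriv (1, 0) p with hq
  set r := dirDeriv (1, 0) q with hr
  set u := dirDeriv (1, 0) r with hu
  set e := δ * Real.exp ((C + 4) * s) with he
  have cq : ContDiffOn ℝ (⊤ : ℕ∞) q quadrant := (hF.dirDeriv _).dirDeriv _
  have cr : ContDiffOn ℝ (⊤ : ℕ∞) r quadrant := cq.dirDeriv _
  have epX : ∀ x t, 0 < x → 0 < t → pX F x t = p (x, t) := fun _ _ => pX_eq_dirDeriv hF
  have epXX : ∀ x t, 0 < x → 0 < t → pXX F x t = q (x, t) := fun _ _ => pXX_eq_dirDeriv hF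
  have hev := dirDeriv_snd_second_derivative_eq hF
    (fun x hx => (diffusion_coefficient_bounds ha hmono hconc hid hx).1)
    (fun x hx => (diffusion_coefficient_bounds ha hmono hconc hid hx).2.1)
    (fun x t hx ht => by
      have := hpde x t hx ht
      rwa [epX x t hx ht, epXX x t hx ht, pT_eq_dirDeriv hF hx ht] at this)
    hp hq hr hu hy hs0
  obtain ⟨-, -, ha₀, hax, ha₁, ha₁', ha₂⟩ := diffusion_coefficient_bounds ha hmono hconc hid hy
  have hpb := hpX y s hy hs0
  rw [epX y s hy hs0] at hpb
  have hG : y * q (y, s) = -(1 / 2 + m + e * (1 + y)) := by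
    have : y * pXX F y s + ((1 / 2 + m) + e * (1 + y)) = 0 := hW₀
    rw [epXX y s hy hs0] at this
    linarith
  have dWx : ∀ z, 0 < z →
      HasDerivAt (fun z => W z s) (q (z, s) + z * r (z, s) + e) z := fun z hz => by
    have h := ((hasDerivAt_id z).mul (cq.hasDerivAt_fst hz hs0)).add
      ((((hasDerivAt_id z).const_add 1).const_mul e).const_add (1 / 2 + m))
    refine (h.congr_of_eventuallyEq (f₁ := fun z => W z s) ?_).congr_deriv (by simp [hr])
    filter_upwards [Ioi_mem_nhds hz] with w hw
    simp [hWdef, epXX w s hw hs0, he]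
  have dWxx : HasDerivAt (fun z => q (z, s) + z * r (z, s) + e)
      (2 * r (y, s) + y * u (y, s)) y := by
    have h := ((cq.hasDerivAt_fst hy hs0).add
      ((hasDerivAt_id y).mul (cr.hasDerivAt_fst hy hs0))).add_const e
    exact h.congr_deriv (by simp only [← hr, ← hu, id]; ring)
  have dWt : HasDerivAt (fun s => W y s)
      (y * dirDeriv (0, 1) q (y, s) + (C + 4) * (e * (1 + y))) s := by
    have h := ((cq.hasDerivAt_snd hy hs0).const_mul y).add
      ((((((hasDerivAt_id s).const_mul (C + 4)).exp).const_mul δ).mul_const (1 + y)).const_add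
        (1 / 2 + m))
    refine (h.congr_of_eventuallyEq (f₁ := fun s => W y s) ?_).congr_deriv
      (by simp only [he, id]; ring)
    filter_upwards [Ioi_mem_nhds hs0] with w hw
    simp [hWdef, epXX y w hy hw]
  have hmin : IsLocalMin (fun z => W z s) y := by
    filter_upwards [Ioi_mem_nhds hy] with z hz
    exact hW₀.trans_le (hWx z (le_of_lt hz))
  have hGx := hmin.hasDerivAt_eq_zero (dWx y hy)
  have hGxx := hmin.zero_le_of_hasDerivAt_hasDerivAt
    (by filter_upwards [Ioi_mem_nhds hy] with z hz using dWx z hz) dWxx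
  have hGt := dWt.nonpos_of_nonneg_left hs0 hWt hW₀
  have he₀ : 0 < e := by positivity
  refine no_touching_barrier hε hε₁ hm₀ hy he₀ (hbound y s hy.le hs0.le) hpb.1 hpb.2 ha₀ hax ha₁
    ha₁' ha₂ hev hG (by linarith) hGxx (C := C) (by linarith) (fun h => ?_) hC.le (fun h => ?_)
  · have hg := (abs_le.1 (hgrowth y h s hsT)).1
    rw [epXX y s hy hs0, hG] at hg
    have : C * √y ≤ C * y := mul_le_mul_of_nonneg_left (Real.sqrt_le_self_iff.2 (.inr h)) hC.le
    linarith
  · have hle : e ≤ δ * Real.exp ((C + 4) * T) :=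
      mul_le_mul_of_nonneg_left
        (Real.exp_le_exp.2 (mul_le_mul_of_nonneg_left hs.2 (by linarith))) hδ.le
    nlinarith

/-- Lemma 3.7, lower second-derivative bound for the degenerate
viscous approximation. Let `0 < m < 1/2`. There exists `ε₀ > 0`, depending only on `m`,
such that for every `F₀` satisfying (A1)–(A3), every admissible diffusion coefficient `a`,
every `0 < ε < ε₀`, and every solution `F = F^ε` of
`∂ₜF + (1/2)(∂ₓF − m)(∂ₓF − m − 1) + F/x − m = ε·a(x)·∂ₓ²F`
(concave in `x`, `0 ≤ ∂ₓF ≤ m`, with `G = x·∂ₓ²F` extending continuously by `0` at `x = 0`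
and uniformly Hölder for the parabolic distance on each `[0,∞)×[0,T]`), one has
`x·∂ₓ²F(x,t) ≥ −(1/2 + m) ≥ −1` on `(0,∞)×(0,∞)`. -/
theorem lower_bound_second_derivative (m : ℝ) (hm₀ : 0 < m) (hm₁ : m < 1 / 2) :
    ∃ ε₀ > 0,
      ∀ F₀ : ℝ → ℝ, ContDiffOn ℝ 2 F₀ (Ici 0) → Sublinear F₀ →
      (∀ x : ℝ, 0 ≤ x → 0 ≤ F₀ x ∧ F₀ x ≤ m * x) →
      ((∀ x : ℝ, 0 ≤ x → 0 ≤ D1 F₀ x ∧ D1 F₀ x ≤ m) ∧ D1 F₀ 0 = m) →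
      (∃ C > 0, ∀ x : ℝ, 0 < x → -C ≤ D2 F₀ x ∧ D2 F₀ x ≤ 0) →
      ((∀ x : ℝ, 0 < x → -(m / Real.exp 1) ≤ x * D2 F₀ x ∧ x * D2 F₀ x ≤ 0) ∧
        ∃ β ∈ Ioo (0 : ℝ) 1, ∃ C > 0,
          (∀ x : ℝ, 0 ≤ x → |x * D2 F₀ x| ≤ C) ∧
          (∀ x y : ℝ, 0 ≤ x → 0 ≤ y → |x * D2 F₀ x - y * D2 F₀ y| ≤ C * |x - y| ^ β)) →
      ∀ a : ℝ → ℝ, ContDiffOn ℝ (⊤ : ℕ∞) a (Ici 0) → MonotoneOn a (Ici 0) →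
      ConcaveOn ℝ (Ici 0) a → (∀ x ∈ Icc (0 : ℝ) 1, a x = x) → (∀ x : ℝ, 3 ≤ x → a x = 2) →
      ∀ ε : ℝ, 0 < ε → ε < ε₀ →
      ∀ F : ℝ → ℝ → ℝ,
        ContinuousOn (fun p : ℝ × ℝ => F p.1 p.2) (Ici 0 ×ˢ Ici 0) →
        ContDiffOn ℝ (⊤ : ℕ∞) (fun p : ℝ × ℝ => F p.1 p.2) (Ioi 0 ×ˢ Ioi 0) →
        (∀ x t : ℝ, 0 < x → 0 < t →
          pT F x t + (1 / 2) * (pX F x t - m) * (pX F x t - m - 1) + F x t / x - m =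
            ε * a x * pXX F x t) →
        (∀ x : ℝ, 0 ≤ x → F x 0 = F₀ x) →
        (∀ t : ℝ, 0 ≤ t → F 0 t = 0) →
        (∀ x t : ℝ, 0 ≤ x → 0 ≤ t → 0 ≤ F x t ∧ F x t ≤ m * x) →
        (∀ t : ℝ, 0 ≤ t → ConcaveOn ℝ (Ici 0) (fun x => F x t)) →
        (∀ x t : ℝ, 0 < x → 0 < t → 0 ≤ pX F x t ∧ pX F x t ≤ m) →
        -- `G(x,t) = x·∂ₓ²F(x,t)` (which vanishes at `x = 0`) is continuous on
        -- `[0,∞)×[0,T]` and uniformly Hölder for the parabolic distance: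
        (∀ T > 0,
          ContinuousOn (fun p : ℝ × ℝ => p.1 * pXX F p.1 p.2) (Ici 0 ×ˢ Icc 0 T) ∧
          ∃ β ∈ Ioo (0 : ℝ) 1, ∃ C > 0, ∀ x₁ t₁ x₂ t₂ : ℝ,
            0 ≤ x₁ → 0 ≤ x₂ → t₁ ∈ Icc (0 : ℝ) T → t₂ ∈ Icc (0 : ℝ) T →
            |x₁ * pXX F x₁ t₁ - x₂ * pXX F x₂ t₂| ≤
              C * (parabolicDist x₁ t₁ x₂ t₂) ^ β) →
        ∀ x t : ℝ, 0 < x → 0 < t →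
          -(1 / 2 + m) ≤ x * pXX F x t ∧ (-1 : ℝ) ≤ x * pXX F x t := by
  refine ⟨(1 / 2 - m) / 4, by linarith, ?_⟩
  intro F₀ _ _ _ _ _ hA3 a ha hmono hconc hid _ ε hε hε₁ F _ hF hpde hF₀ _ hbound _ hpX hG x t hx ht
  suffices h : -(1 / 2 + m) ≤ x * pXX F x t from ⟨h, by linarith⟩
  obtain ⟨hcont, β, hβ, C, hC, hholder⟩ := hG t ht
  have hpX₀ : ∀ y ∈ Ici (0 : ℝ), pX F y 0 = derivWithin F₀ (Ici 0) y := fun y hy =>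
    derivWithin_congr (fun z hz => hF₀ z hz) (hF₀ y hy)
  have hzero : ∀ y, 0 ≤ y → -(1 / 2 + m) < y * pXX F y 0 := fun y hy => by
    have hD : pXX F y 0 = D2 F₀ y := derivWithin_congr hpX₀ (hpX₀ y hy)
    rcases hy.eq_or_lt with rfl | hy
    · linarith
    · have h := (hA3.1 y hy).1
      have : m / Real.exp 1 ≤ m := div_le_self hm₀.le (Real.one_le_exp zero_le_one)
      rw [hD]
      linarith
  have hgrowth : ∀ y, 1 ≤ y → ∀ s ∈ Icc 0 t, |y * pXX F y s| ≤ C * √y := fun y hy s hs =>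
    abs_le_sqrt_of_parabolic_holder (G := fun y s => y * pXX F y s) hβ.2.le hC.le hy (zero_mul _)
      (hholder y s 0 s (by linarith) le_rfl hs hs)
  set B := Real.exp ((C + 4) * t) * (1 + x) with hB
  have hlim : Tendsto (fun δ => x * pXX F x t + ((1 / 2 + m) + δ * B)) (nhdsWithin 0 (Ioi 0))
      (nhds (x * pXX F x t + ((1 / 2 + m) + 0 * B))) :=
    (Continuous.tendsto (by fun_prop) 0).mono_left nhdsWithin_le_nhds
  have hlim₂ : Tendsto (fun δ => 2 * (δ * Real.exp ((C + 4) * t))) (nhdsWithin 0 (Ioi 0))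
      (nhds (2 * (0 * Real.exp ((C + 4) * t)))) :=
    (Continuous.tendsto (by fun_prop) 0).mono_left nhdsWithin_le_nhds
  have hge := ge_of_tendsto (b := 0) hlim (by
    filter_upwards [self_mem_nhdsWithin, hlim₂.eventually_le_const
      (u := (1 / 2 - m) / 16) (by linarith)] with δ hδ hδ₁
    have := barrier_le hm₀ hε hε₁ ha hmono hconc hid hF hpde
      (fun y s hy hs => (hbound y s hy hs).2) hpX hcont hzero hC hgrowth hδ hδ₁ hx.le
      ⟨ht.le, le_rfl⟩
    rwa [mul_assoc] at this)
  linarith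
end
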